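/- arXiv:1306.6220 — 2 statements merged into one kernel-verified Lean document; each statement's English description precedes it below -/
import Mathlib

section
/- Let k ∈ (0,1) and let u, v ∈ (0, K(k)) with u < v. Then ∂/∂u { log( H(v−u, k)/H(v+u, k) ) } = 2 sn(v,k) cn(v,k) dn(v,k) / (sn²(u,k) − sn²(v,k)) − 2 zn(v,k). -/
open Real

/-- Complete elliptic integral of the first kind. -/
noncomputable def EllK (k : ℝ) : ℝ :=
  ∫ θ in (0:ℝ)..(π/2), 1 / Real.sqrt (1 - k^2 * Real.sin θ ^ 2)

/-- Complete elliptic integral of the second kind. -/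
noncomputable def EllE (k : ℝ) : ℝ :=
  ∫ θ in (0:ℝ)..(π/2), Real.sqrt (1 - k^2 * Real.sin θ ^ 2)

/-- Complementary complete elliptic integral `K'(k) = K(√(1-k²))`. -/
noncomputable def EllK' (k : ℝ) : ℝ := EllK (Real.sqrt (1 - k^2))

/-- Complementary elliptic integral of the second kind `E'(k) = E(√(1-k²))`. -/
noncomputable def EllE' (k : ℝ) : ℝ := EllE (Real.sqrt (1 - k^2))

/-- The nome `q = exp(-π K'(k)/K(k))`. -/
noncomputable def nome (k : ℝ) : ℝ := Real.exp (-π * EllK' k / EllK k)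

/-- Jacobi's theta function `Θ(u,k) = 1 + 2 ∑_{n≥1} (-1)^n q^{n²} cos(nπu/K)`. -/
noncomputable def JTheta (u k : ℝ) : ℝ :=
  1 + 2 * ∑' n : ℕ, (-1 : ℝ)^(n+1) * nome k ^ ((n+1)^2) *
    Real.cos (((n:ℝ)+1) * π * u / EllK k)

/-- Jacobi's theta function `H(u,k) = 2 ∑_{n≥0} (-1)^n q^{(n+1/2)²} sin((2n+1)πu/(2K))`. -/
noncomputable def JH (u k : ℝ) : ℝ :=
  2 * ∑' n : ℕ, (-1 : ℝ)^n * nome k ^ ((((n:ℝ) + 1/2)^2)) *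
    Real.sin ((2*(n:ℝ)+1) * π * u / (2 * EllK k))

/-- Jacobi's theta function `H₁(u,k) = 2 ∑_{n≥0} q^{(n+1/2)²} cos((2n+1)πu/(2K))`. -/
noncomputable def JH1 (u k : ℝ) : ℝ :=
  2 * ∑' n : ℕ, nome k ^ ((((n:ℝ) + 1/2)^2)) *
    Real.cos ((2*(n:ℝ)+1) * π * u / (2 * EllK k))

/-- Jacobi's theta function `Θ₁(u,k) = 1 + 2 ∑_{n≥1} q^{n²} cos(nπu/K)`. -/
noncomputable def JTheta1 (u k : ℝ) : ℝ :=
  1 + 2 * ∑' n : ℕ, nome k ^ ((n+1)^2) * Real.cos (((n:ℝ)+1) * π * u / EllK k)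

/-- Jacobi's zeta function `zn(u,k) = Θ_u(u,k)/Θ(u,k)`. -/
noncomputable def zn (u k : ℝ) : ℝ := deriv (fun v => JTheta v k) u / JTheta u k

/-- Jacobi's elliptic sine `sn(u,k) = H(u,k)/(√k Θ(u,k))`. -/
noncomputable def sn (u k : ℝ) : ℝ := JH u k / (Real.sqrt k * JTheta u k)

/-- Jacobi's elliptic cosine `cn(u,k) = √(k'/k) H₁(u,k)/Θ(u,k)`. -/
noncomputable def cn (u k : ℝ) : ℝ :=
  Real.sqrt (Real.sqrt (1 - k^2) / k) * JH1 u k / JTheta u k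

/-- Jacobi's delta amplitude `dn(u,k) = √(k') Θ₁(u,k)/Θ(u,k)`. -/
noncomputable def dn (u k : ℝ) : ℝ :=
  Real.sqrt (Real.sqrt (1 - k^2)) * JTheta1 u k / JTheta u k


/-! ### The theta function with half-integer characteristic -/

/-- `∑ₙ exp (2πi (n + 1/2) z + πi (n + 1/2)² τ)`, in terms of the two-variable Jacobi theta
function. -/
noncomputable def halfTheta (z τ : ℂ) : ℂ :=
  Complex.exp (π * Complex.I * (z + τ / 4)) * jacobiTheta₂ (z + τ / 2) τ

theorem hasSum_halfTheta (z : ℂ) {τ : ℂ} (hτ : 0 < τ.im) :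
    HasSum (fun n : ℤ => Complex.exp (2 * π * Complex.I * (n + 1 / 2) * z +
      π * Complex.I * (n + 1 / 2) ^ 2 * τ)) (halfTheta z τ) := by
  refine ((hasSum_jacobiTheta₂_term (z + τ / 2) hτ).mul_left
    (Complex.exp (π * Complex.I * (z + τ / 4)))).congr_fun ?_
  intro n
  rw [jacobiTheta₂_term, ← Complex.exp_add]
  congr 1
  ring

/-- The splitting of `ℤ × ℤ` into pairs of equal and of opposite parity. -/
def paritySplit : (ℤ × ℤ) ⊕ (ℤ × ℤ) ≃ ℤ × ℤ where
  toFun s := s.elim (fun p => (p.1 + p.2, p.1 - p.2)) (fun p => (p.1 + p.2 + 1, p.1 - p.2))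
  invFun p := if (p.1 + p.2) % 2 = 0 then Sum.inl ((p.1 + p.2) / 2, (p.1 - p.2) / 2)
    else Sum.inr ((p.1 + p.2) / 2, (p.1 - p.2) / 2)
  left_inv := by
    rintro (⟨a, b⟩ | ⟨a, b⟩)
    · have h : (a + b + (a - b)) % 2 = 0 := by omega
      simp only [Sum.elim_inl, h, if_true, Sum.inl.injEq, Prod.mk.injEq]
      omega
    · have h : ¬ (a + b + 1 + (a - b)) % 2 = 0 := by omega
      simp only [Sum.elim_inr, h, if_false, Sum.inr.injEq, Prod.mk.injEq]
      omega
  right_inv := by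
    rintro ⟨a, b⟩
    by_cases h : (a + b) % 2 = 0
    · simp only [h, if_true, Sum.elim_inl, Prod.mk.injEq]
      omega
    · simp only [h, if_false, Sum.elim_inr, Prod.mk.injEq]
      omega

theorem HasSum.mul_prod_complex {f g : ℤ → ℂ} {a b : ℂ} (hf : HasSum f a) (hg : HasSum g b) :
    HasSum (fun p : ℤ × ℤ => f p.1 * g p.2) (a * b) :=
  hf.mul hg (summable_mul_of_summable_norm hf.summable.norm hg.summable.norm)

theorem jacobiTheta₂_mul_jacobiTheta₂ (z w : ℂ) {τ : ℂ} (hτ : 0 < τ.im) :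
    jacobiTheta₂ z τ * jacobiTheta₂ w τ =
      jacobiTheta₂ (z + w) (2 * τ) * jacobiTheta₂ (z - w) (2 * τ) +
        halfTheta (z + w) (2 * τ) * halfTheta (z - w) (2 * τ) := by
  have hτ2 : 0 < (2 * τ).im := by simpa using hτ
  have h1 := (hasSum_jacobiTheta₂_term z hτ).mul_prod_complex (hasSum_jacobiTheta₂_term w hτ)
  have h2 := (hasSum_jacobiTheta₂_term (z + w) hτ2).mul_prod_complex
    (hasSum_jacobiTheta₂_term (z - w) hτ2)
  have h3 := (hasSum_halfTheta (z + w) hτ2).mul_prod_complex (hasSum_halfTheta (z - w) hτ2)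
  rw [← paritySplit.hasSum_iff] at h1
  refine h1.unique (HasSum.sum ?_ ?_)
  · refine h2.congr_fun fun p => ?_
    simp only [Function.comp, paritySplit, Equiv.coe_fn_mk, Sum.elim_inl, jacobiTheta₂_term,
      ← Complex.exp_add]
    congr 1
    push_cast
    ring
  · refine h3.congr_fun fun p => ?_
    simp only [Function.comp, paritySplit, Equiv.coe_fn_mk, Sum.elim_inr, jacobiTheta₂_term,
      ← Complex.exp_add]
    congr 1
    push_cast
    ring

theorem halfTheta_mul_halfTheta (z w : ℂ) {τ : ℂ} (hτ : 0 < τ.im) :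
    halfTheta z τ * halfTheta w τ =
      halfTheta (z + w) (2 * τ) * jacobiTheta₂ (z - w) (2 * τ) +
        jacobiTheta₂ (z + w) (2 * τ) * halfTheta (z - w) (2 * τ) := by
  have h := jacobiTheta₂_mul_jacobiTheta₂ (z + τ / 2) (w + τ / 2) hτ
  have e1 : z + τ / 2 + (w + τ / 2) = z + w + τ := by ring
  have e2 : z + τ / 2 - (w + τ / 2) = z - w := by ring
  have e3 : z + w + τ + 2 * τ / 2 = z + w + 2 * τ := by ring
  have e4 : z + w + 2 * τ / 2 = z + w + τ := by ring
  rw [e1, e2] at h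
  have h2 : halfTheta (z + w + τ) (2 * τ) =
      Complex.exp (-(π * Complex.I * (z + w + τ / 2))) * jacobiTheta₂ (z + w) (2 * τ) := by
    rw [halfTheta, e3, jacobiTheta₂_add_left', ← mul_assoc, ← Complex.exp_add]
    congr 2
    ring
  have h3 : halfTheta z τ * halfTheta w τ = Complex.exp (π * Complex.I * (z + w + τ / 2)) *
      (jacobiTheta₂ (z + τ / 2) τ * jacobiTheta₂ (w + τ / 2) τ) := by
    have : Complex.exp (π * Complex.I * (z + w + τ / 2)) =
      Complex.exp (π * Complex.I * (z + τ / 4)) * Complex.exp (π * Complex.I * (w + τ / 4)) := by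
        rw [← Complex.exp_add]; congr 1; ring
    rw [this, halfTheta, halfTheta]
    ring
  have h4 : halfTheta (z + w) (2 * τ) = Complex.exp (π * Complex.I * (z + w + τ / 2)) *
      jacobiTheta₂ (z + w + τ) (2 * τ) := by
    rw [halfTheta, e4]
    congr 3
    ring
  rw [h3, h, h2, h4, Complex.exp_neg]
  field_simp [Complex.exp_ne_zero]

theorem differentiableAt_halfTheta (z : ℂ) {τ : ℂ} (hτ : 0 < τ.im) :
    DifferentiableAt ℂ (halfTheta · τ) z := by
  have h := (differentiableAt_jacobiTheta₂_fst (z + τ / 2) hτ).comp z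
    (by fun_prop : DifferentiableAt ℂ (fun z : ℂ => z + τ / 2) z)
  exact (by fun_prop : DifferentiableAt ℂ
    (fun z : ℂ => Complex.exp (π * Complex.I * (z + τ / 4))) z).mul h

theorem halfTheta_functional_equation (z : ℂ) {τ : ℂ} (hτ : 0 < τ.im) :
    halfTheta (z / τ - 1 / 2) (-1 / τ) = -Complex.I * (-Complex.I * τ) ^ (1 / 2 : ℂ) *
      Complex.exp (π * Complex.I * z ^ 2 / τ) * halfTheta (z - 1 / 2) τ := by
  have hτ0 : τ ≠ 0 := by rintro rfl; simp at hτ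
  have hc : (-Complex.I * τ) ^ (1 / 2 : ℂ) ≠ 0 := by
    simp [Complex.cpow_eq_zero_iff, hτ0]
  have h1 := jacobiTheta₂_functional_equation (z - τ / 2 - 1 / 2) τ
  have e1 : z / τ - 1 / 2 + -1 / τ / 2 = (z - τ / 2 - 1 / 2) / τ := by field_simp; ring
  have e2 : z - 1 / 2 + τ / 2 = z - τ / 2 - 1 / 2 + τ := by ring
  have hI : -Complex.I = Complex.exp (-(π / 2 * Complex.I)) := by
    rw [Complex.exp_neg, Complex.exp_pi_div_two_mul_I, Complex.inv_I]
  rw [halfTheta, halfTheta, e1, e2, jacobiTheta₂_add_left', h1]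
  generalize (-Complex.I * τ) ^ (1 / 2 : ℂ) = c at hc
  rw [hI]
  generalize jacobiTheta₂ ((z - τ / 2 - 1 / 2) / τ) (-1 / τ) = J
  have : Complex.exp (π * Complex.I * (z / τ - 1 / 2 + -1 / τ / 4)) =
      Complex.exp (-(π / 2 * Complex.I)) * Complex.exp (π * Complex.I * z ^ 2 / τ) *
      Complex.exp (π * Complex.I * (z - 1 / 2 + τ / 4)) *
      Complex.exp (-π * Complex.I * (τ + 2 * (z - τ / 2 - 1 / 2))) *
      Complex.exp (-π * Complex.I * (z - τ / 2 - 1 / 2) ^ 2 / τ) := by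
    simp only [← Complex.exp_add]
    congr 1
    field_simp
    ring
  rw [this]
  field_simp

/-! ### Real theta functions -/

/-- The Jacobi theta function `θ₃` at the angle `π x`, with nome `exp (-π t)`. -/
noncomputable def theta3 (x t : ℝ) : ℝ := HurwitzZeta.cosKernel (x : UnitAddCircle) t

/-- The Jacobi theta function `θ₂` at the angle `π x`, with nome `exp (-π t)`. -/
noncomputable def theta2 (x t : ℝ) : ℝ :=
  ∑' n : ℕ, 2 * Real.cos (2 * π * (n + 1 / 2) * x) * Real.exp (-π * (n + 1 / 2) ^ 2 * t)

theorem I_mul_im_pos {t : ℝ} (ht : 0 < t) : 0 < (Complex.I * t).im := by simpa using ht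

theorem ofReal_theta3 (x t : ℝ) : (theta3 x t : ℂ) = jacobiTheta₂ x (Complex.I * t) :=
  HurwitzZeta.cosKernel_def x t

theorem hasSum_ofReal_halfTheta (x : ℝ) {t : ℝ} (ht : 0 < t) :
    HasSum (fun n : ℕ => ((2 * Real.cos (2 * π * (n + 1 / 2) * x) *
      Real.exp (-π * (n + 1 / 2) ^ 2 * t) : ℝ) : ℂ)) (halfTheta x (Complex.I * t)) := by
  refine (hasSum_halfTheta x (I_mul_im_pos ht)).nat_add_neg_add_one.congr_fun fun n => ?_
  push_cast
  rw [Complex.two_cos, add_mul, ← Complex.exp_add, ← Complex.exp_add]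
  congr 2
  · linear_combination (-π * ((n : ℂ) + 1 / 2) ^ 2 * t) * Complex.I_mul_I
  · linear_combination (-π * ((n : ℂ) + 1 / 2) ^ 2 * t) * Complex.I_mul_I

theorem ofReal_theta2 (x : ℝ) {t : ℝ} (ht : 0 < t) :
    (theta2 x t : ℂ) = halfTheta x (Complex.I * t) := by
  rw [theta2, Complex.ofReal_tsum]
  exact (hasSum_ofReal_halfTheta x ht).tsum_eq

theorem hasSum_theta2 (x : ℝ) {t : ℝ} (ht : 0 < t) :
    HasSum (fun n : ℕ => 2 * Real.cos (2 * π * (n + 1 / 2) * x) *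
      Real.exp (-π * (n + 1 / 2) ^ 2 * t)) (theta2 x t) := by
  rw [← Complex.hasSum_ofReal, ofReal_theta2 x ht]
  exact hasSum_ofReal_halfTheta x ht

theorem hasSum_theta3 (x : ℝ) {t : ℝ} (ht : 0 < t) :
    HasSum (fun n : ℕ => 2 * Real.cos (2 * π * x * (n + 1)) *
      Real.exp (-π * (n + 1) ^ 2 * t)) (theta3 x t - 1) :=
  HurwitzZeta.hasSum_nat_cosKernel₀ x ht

theorem theta3_mul_theta3 (x y : ℝ) {t : ℝ} (ht : 0 < t) :
    theta3 x t * theta3 y t = theta3 (x + y) (2 * t) * theta3 (x - y) (2 * t) +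
      theta2 (x + y) (2 * t) * theta2 (x - y) (2 * t) := by
  have h := jacobiTheta₂_mul_jacobiTheta₂ x y (I_mul_im_pos ht)
  have e : 2 * (Complex.I * t) = Complex.I * ((2 * t : ℝ) : ℂ) := by push_cast; ring
  have h2 : 0 < 2 * t := by positivity
  rw [e, ← Complex.ofReal_add, ← Complex.ofReal_sub, ← ofReal_theta2 _ h2,
    ← ofReal_theta2 _ h2] at h
  simp only [← ofReal_theta3] at h
  exact_mod_cast h

theorem theta2_mul_theta2 (x y : ℝ) {t : ℝ} (ht : 0 < t) :
    theta2 x t * theta2 y t = theta2 (x + y) (2 * t) * theta3 (x - y) (2 * t) +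
      theta3 (x + y) (2 * t) * theta2 (x - y) (2 * t) := by
  have h := halfTheta_mul_halfTheta x y (I_mul_im_pos ht)
  have e : 2 * (Complex.I * t) = Complex.I * ((2 * t : ℝ) : ℂ) := by push_cast; ring
  have h2 : 0 < 2 * t := by positivity
  rw [e, ← Complex.ofReal_add, ← Complex.ofReal_sub, ← ofReal_theta2 _ h2,
    ← ofReal_theta2 _ h2, ← ofReal_theta2 _ ht, ← ofReal_theta2 _ ht] at h
  simp only [← ofReal_theta3] at h
  exact_mod_cast h

theorem theta3_add_one (x t : ℝ) : theta3 (x + 1) t = theta3 x t := by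
  simp [theta3]

theorem theta2_neg (x t : ℝ) : theta2 (-x) t = theta2 x t := by
  simp [theta2]

theorem theta2_add_one (x t : ℝ) : theta2 (x + 1) t = -theta2 x t := by
  rw [theta2, theta2, ← tsum_neg]
  congr 1 with n
  have : 2 * π * (n + 1 / 2) * (x + 1) = 2 * π * (n + 1 / 2) * x + π + n * (2 * π) := by ring
  rw [this, Real.cos_add_nat_mul_two_pi, Real.cos_add_pi]
  ring

theorem theta2_neg_half (t : ℝ) : theta2 (-(1 / 2)) t = 0 := by
  have h := theta2_add_one (-(1 / 2)) t
  rw [show -(1 / 2) + 1 = (1 / 2 : ℝ) by norm_num, ← theta2_neg] at h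
  linarith

theorem differentiableAt_theta3 (x : ℝ) {t : ℝ} (ht : 0 < t) :
    DifferentiableAt ℝ (theta3 · t) x := by
  have h := (differentiableAt_jacobiTheta₂_fst x (I_mul_im_pos ht)).hasDerivAt.real_of_complex
  refine (h.congr_of_eventuallyEq (.of_forall fun y => ?_)).differentiableAt
  simp only [← ofReal_theta3, Complex.ofReal_re]

theorem hasDerivAt_theta2 (x : ℝ) {t : ℝ} (ht : 0 < t) :
    HasDerivAt (theta2 · t) (deriv (halfTheta · (Complex.I * t)) x).re x := by
  have h := (differentiableAt_halfTheta x (I_mul_im_pos ht)).hasDerivAt.real_of_complex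
  refine h.congr_of_eventuallyEq (.of_forall fun y => ?_)
  simp only [← ofReal_theta2 _ ht, Complex.ofReal_re]

theorem differentiableAt_theta2 (x : ℝ) {t : ℝ} (ht : 0 < t) :
    DifferentiableAt ℝ (theta2 · t) x :=
  (hasDerivAt_theta2 x ht).differentiableAt

theorem continuous_theta3 {t : ℝ} (ht : 0 < t) : Continuous (theta3 · t) :=
  continuous_iff_continuousAt.2 fun x => (differentiableAt_theta3 x ht).continuousAt

/-- The derivative of `θ₁` at the origin. -/
noncomputable def theta1Deriv (t : ℝ) : ℝ := deriv (theta2 · t) (-(1 / 2))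

theorem hasDerivAt_halfTheta_neg_half {t : ℝ} (ht : 0 < t) :
    HasDerivAt (halfTheta · (Complex.I * t)) (theta1Deriv t : ℂ) (-(1 / 2)) := by
  have h1 := (differentiableAt_theta2 (-(1 / 2)) ht).hasDerivAt.ofReal_comp
  have h2 := (differentiableAt_halfTheta ((-(1 / 2) : ℝ) : ℂ)
    (I_mul_im_pos ht)).hasDerivAt
  have h3 := h1.unique (h2.comp_ofReal.congr_of_eventuallyEq
    (.of_forall fun y => ofReal_theta2 y ht))
  rw [theta1Deriv, h3]
  simpa using h2

theorem theta3_pos (x : ℝ) {t : ℝ} (ht : 0 < t) : 0 < theta3 x t := by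
  have ht' : 0 < 1 / t := by positivity
  have h1 := HurwitzZeta.evenKernel_functional_equation (x : UnitAddCircle) (1 / t)
  have h2 := HurwitzZeta.hasSum_int_evenKernel x ht'
  have h3 : 0 < HurwitzZeta.evenKernel (x : UnitAddCircle) (1 / t) := by
    rw [← h2.tsum_eq]
    exact h2.summable.tsum_pos (fun n => (Real.exp_pos _).le) 0 (Real.exp_pos _)
  rw [h1, one_div_one_div] at h3
  exact pos_of_mul_pos_right h3 (by positivity)

theorem theta2_zero_eq_evenKernel {t : ℝ} (ht : 0 < t) :
    theta2 0 t = HurwitzZeta.evenKernel ((1 / 2 : ℝ) : UnitAddCircle) t := by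
  rw [← Complex.ofReal_inj, ofReal_theta2 0 ht, HurwitzZeta.evenKernel_def, halfTheta]
  congr 2
  · push_cast
    linear_combination (π * t / 4 : ℂ) * Complex.I_mul_I
  · push_cast; ring

theorem theta2_zero_pos {t : ℝ} (ht : 0 < t) : 0 < theta2 0 t := by
  have h2 := HurwitzZeta.hasSum_int_evenKernel (1 / 2) ht
  rw [theta2_zero_eq_evenKernel ht, ← h2.tsum_eq]
  exact h2.summable.tsum_pos (fun n => (Real.exp_pos _).le) 0 (Real.exp_pos _)

theorem theta2_zero_one_div {t : ℝ} (ht : 0 < t) :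
    theta2 0 (1 / t) = √t * theta3 (1 / 2) t := by
  rw [theta2_zero_eq_evenKernel (by positivity), HurwitzZeta.evenKernel_functional_equation,
    one_div_one_div, ← Real.sqrt_eq_rpow, Real.sqrt_div zero_le_one, theta3]
  simp

theorem theta3_half_one_div {t : ℝ} (ht : 0 < t) :
    theta3 (1 / 2) (1 / t) = √t * theta2 0 t := by
  have h := theta2_zero_one_div (t := 1 / t) (by positivity)
  rw [one_div_one_div, Real.sqrt_div zero_le_one] at h
  have : 0 < √t := Real.sqrt_pos.2 ht
  rw [h]
  field_simp
  simp

theorem theta3_zero_one_div (t : ℝ) :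
    theta3 0 (1 / t) = √t * theta3 0 t := by
  have h := HurwitzZeta.evenKernel_functional_equation 0 (1 / t)
  rw [HurwitzZeta.evenKernel_eq_cosKernel_of_zero, one_div_one_div, ← Real.sqrt_eq_rpow,
    Real.sqrt_div zero_le_one] at h
  simpa [theta3] using h

theorem theta1Deriv_one_div {t : ℝ} (ht : 0 < t) :
    theta1Deriv (1 / t) = t * √t * theta1Deriv t := by
  have hfe (z : ℂ) : halfTheta (z / (Complex.I * t) - 1 / 2) (Complex.I * (1 / t : ℝ)) =
      -Complex.I * √t * Complex.exp (π * Complex.I * z ^ 2 / (Complex.I * t)) *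
        halfTheta (z - 1 / 2) (Complex.I * t) := by
    have h := halfTheta_functional_equation z (I_mul_im_pos ht)
    have e1 : -1 / (Complex.I * t) = Complex.I * (1 / t : ℝ) := by
      push_cast
      rw [div_mul_eq_div_div, neg_div, Complex.div_I]
      ring
    have e2 : (-Complex.I * (Complex.I * t)) ^ (1 / 2 : ℂ) = (√t : ℂ) := by
      rw [← mul_assoc, neg_mul, Complex.I_mul_I, neg_neg, one_mul, Real.sqrt_eq_rpow,
        Complex.ofReal_cpow ht.le]
      norm_num
    rw [e1, e2] at h
    exact h
  have hl : HasDerivAt (fun z : ℂ => halfTheta (z / (Complex.I * t) - 1 / 2)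
      (Complex.I * (1 / t : ℝ))) (theta1Deriv (1 / t) * (1 / (Complex.I * t))) 0 := by
    refine HasDerivAt.comp (h₂ := (halfTheta · (Complex.I * (1 / t : ℝ)))) (0 : ℂ) ?_
      (((hasDerivAt_id (0 : ℂ)).div_const (Complex.I * t)).sub_const (1 / 2))
    simpa using hasDerivAt_halfTheta_neg_half (t := 1 / t) (by positivity)
  have hr : HasDerivAt (fun z : ℂ => halfTheta (z - 1 / 2) (Complex.I * t))
      (theta1Deriv t : ℂ) 0 := by
    have := HasDerivAt.comp_sub_const (0 : ℂ) (1 / 2)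
      (f := (halfTheta · (Complex.I * t))) (f' := (theta1Deriv t : ℂ))
      (by simpa using hasDerivAt_halfTheta_neg_half ht)
    exact this
  have hz : halfTheta (-(1 / 2)) (Complex.I * t) = 0 := by
    have := ofReal_theta2 (-(1 / 2)) ht
    rw [theta2_neg_half] at this
    simpa using this.symm
  have he : HasDerivAt (fun z : ℂ => -Complex.I * √t *
      Complex.exp (π * Complex.I * z ^ 2 / (Complex.I * t)))
      (deriv (fun z : ℂ => -Complex.I * √t *
      Complex.exp (π * Complex.I * z ^ 2 / (Complex.I * t))) 0) 0 :=
    DifferentiableAt.hasDerivAt (by fun_prop)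
  have h := hl.unique ((he.mul hr).congr_of_eventuallyEq (.of_forall hfe))
  simp only [zero_sub, hz, mul_zero, zero_add] at h
  have htc : (t : ℂ) ≠ 0 := by exact_mod_cast ht.ne'
  rw [← Complex.ofReal_inj]
  push_cast
  field_simp at h
  simp only [one_div, ne_eq, OfNat.ofNat_ne_zero, not_false_eq_true, zero_pow, mul_zero, zero_div,
    Complex.exp_zero, neg_mul, Complex.I_sq, mul_one, one_mul, neg_neg] at h ⊢
  exact h

/-- The Jacobi theta function `θ₄` at the angle `π x`, with nome `exp (-π t)`. -/
noncomputable def theta4 (x t : ℝ) : ℝ := theta3 (x + 1 / 2) t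

/-- The Jacobi theta function `θ₁` at the angle `π x`, with nome `exp (-π t)`. -/
noncomputable def theta1 (x t : ℝ) : ℝ := theta2 (x - 1 / 2) t

theorem theta4_pos (x : ℝ) {t : ℝ} (ht : 0 < t) : 0 < theta4 x t := theta3_pos _ ht

theorem theta3_sub_half (x t : ℝ) : theta3 (x - 1 / 2) t = theta4 x t := by
  rw [theta4, ← theta3_add_one]
  congr 1
  ring

theorem theta2_add_half (x t : ℝ) : theta2 (x + 1 / 2) t = -theta1 x t := by
  rw [theta1, ← theta2_add_one]
  congr 1
  ring

theorem theta1_neg (x t : ℝ) : theta1 (-x) t = -theta1 x t := by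
  rw [theta1, ← theta2_add_half, ← theta2_neg]
  congr 1
  ring

theorem theta1_zero (t : ℝ) : theta1 0 t = 0 := by
  have h := theta1_neg 0 t
  rw [neg_zero] at h
  linarith

theorem theta1_half (t : ℝ) : theta1 (1 / 2) t = theta2 0 t := by simp [theta1]

theorem theta1_one_sub (x t : ℝ) : theta1 (1 - x) t = theta1 x t := by
  rw [theta1, theta1, ← theta2_neg]
  congr 1
  ring

theorem theta4_half (t : ℝ) : theta4 (1 / 2) t = theta3 0 t := by
  rw [theta4, ← theta3_add_one 0]
  norm_num

theorem theta4_mul_theta4 (x y : ℝ) {t : ℝ} (ht : 0 < t) :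
    theta4 x t * theta4 y t = theta3 (x + y) (2 * t) * theta3 (x - y) (2 * t) -
      theta2 (x + y) (2 * t) * theta2 (x - y) (2 * t) := by
  rw [theta4, theta4, theta3_mul_theta3 _ _ ht, show x + 1 / 2 + (y + 1 / 2) = x + y + 1 by ring,
    show x + 1 / 2 - (y + 1 / 2) = x - y by ring, theta3_add_one, theta2_add_one]
  ring

theorem theta1_mul_theta1 (x y : ℝ) {t : ℝ} (ht : 0 < t) :
    theta1 x t * theta1 y t = theta3 (x + y) (2 * t) * theta2 (x - y) (2 * t) -
      theta2 (x + y) (2 * t) * theta3 (x - y) (2 * t) := by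
  have h : theta1 x t * theta1 y t = theta2 (x + 1 / 2) t * theta2 (y + 1 / 2) t := by
    rw [theta2_add_half, theta2_add_half]
    ring
  rw [h, theta2_mul_theta2 _ _ ht, show x + 1 / 2 + (y + 1 / 2) = x + y + 1 by ring,
    show x + 1 / 2 - (y + 1 / 2) = x - y by ring, theta3_add_one, theta2_add_one]
  ring

theorem theta1_mul_theta2 (x y : ℝ) {t : ℝ} (ht : 0 < t) :
    theta1 x t * theta2 y t = theta1 (x + y) (2 * t) * theta4 (x - y) (2 * t) +
      theta4 (x + y) (2 * t) * theta1 (x - y) (2 * t) := by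
  rw [theta1, theta2_mul_theta2 _ _ ht, show x - 1 / 2 + y = x + y - 1 / 2 by ring,
    show x - 1 / 2 - y = x - y - 1 / 2 by ring, theta3_sub_half, theta3_sub_half, theta1, theta1]

theorem theta4_mul_theta3 (x y : ℝ) {t : ℝ} (ht : 0 < t) :
    theta4 x t * theta3 y t = theta4 (x + y) (2 * t) * theta4 (x - y) (2 * t) +
      theta1 (x + y) (2 * t) * theta1 (x - y) (2 * t) := by
  rw [← theta3_sub_half, theta3_mul_theta3 _ _ ht, show x - 1 / 2 + y = x + y - 1 / 2 by ring,
    show x - 1 / 2 - y = x - y - 1 / 2 by ring, theta3_sub_half, theta3_sub_half, theta1, theta1]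

theorem theta1_mul_theta2_self (x : ℝ) {t : ℝ} (ht : 0 < t) :
    theta1 x t * theta2 x t = theta1 (2 * x) (2 * t) * theta4 0 (2 * t) := by
  rw [theta1_mul_theta2 _ _ ht, sub_self, theta1_zero, mul_zero, add_zero, ← two_mul]

theorem theta1_add_mul_theta1_sub (x y : ℝ) {t : ℝ} (ht : 0 < t) :
    theta1 (x + y) t * theta1 (x - y) t * theta4 0 t ^ 2 =
      theta1 x t ^ 2 * theta4 y t ^ 2 - theta4 x t ^ 2 * theta1 y t ^ 2 := by
  simp only [sq, theta1_mul_theta1 _ _ ht, theta4_mul_theta4 _ _ ht, sub_self, add_zero]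
  rw [show x + y + (x - y) = x + x by ring, show x + y - (x - y) = y + y by ring]
  ring

theorem theta2_sq (x : ℝ) {t : ℝ} (ht : 0 < t) :
    theta2 x t ^ 2 * theta4 0 t ^ 2 =
      theta4 x t ^ 2 * theta2 0 t ^ 2 - theta1 x t ^ 2 * theta3 0 t ^ 2 := by
  simp only [sq, theta1_mul_theta1 _ _ ht, theta4_mul_theta4 _ _ ht, theta2_mul_theta2 _ _ ht,
    theta3_mul_theta3 _ _ ht, sub_self, add_zero]
  ring

theorem theta3_sq (x : ℝ) {t : ℝ} (ht : 0 < t) :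
    theta3 x t ^ 2 * theta4 0 t ^ 2 =
      theta4 x t ^ 2 * theta3 0 t ^ 2 - theta1 x t ^ 2 * theta2 0 t ^ 2 := by
  simp only [sq, theta1_mul_theta1 _ _ ht, theta4_mul_theta4 _ _ ht, theta2_mul_theta2 _ _ ht,
    theta3_mul_theta3 _ _ ht, sub_self, add_zero]
  ring

theorem theta3_zero_pow_four {t : ℝ} (ht : 0 < t) :
    theta3 0 t ^ 4 = theta2 0 t ^ 4 + theta4 0 t ^ 4 := by
  have h (a : ℝ) : a ^ 4 = (a * a) * (a * a) := by ring
  simp only [h, theta4_mul_theta4 _ _ ht, theta2_mul_theta2 _ _ ht,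
    theta3_mul_theta3 _ _ ht, sub_self, add_zero]
  ring

theorem theta1_two_mul (x : ℝ) {t : ℝ} (ht : 0 < t) :
    theta1 (2 * x) t * (theta2 0 t * theta3 0 t * theta4 0 t) =
      2 * theta1 x t * theta2 x t * theta3 x t * theta4 x t := by
  have h1 := theta1_mul_theta2_self x ht
  have h2 := theta4_mul_theta3 x x ht
  have h3 := theta4_mul_theta3 0 0 ht
  have h4 := theta1_mul_theta2 (2 * x) 0 ht
  simp only [sub_self, add_zero, sub_zero, theta1_zero, mul_zero, ← two_mul] at h2 h3 h4
  linear_combination theta4 0 t * theta3 0 t * h4 +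
    2 * theta1 (2 * x) (2 * t) * theta4 (2 * x) (2 * t) * h3 -
    2 * theta4 x t * theta3 x t * h1 - 2 * theta1 (2 * x) (2 * t) * theta4 0 (2 * t) * h2

theorem differentiableAt_theta1 (x : ℝ) {t : ℝ} (ht : 0 < t) :
    DifferentiableAt ℝ (theta1 · t) x :=
  ((differentiableAt_theta2 (x - 1 / 2) ht).hasDerivAt.comp_sub_const x (1 / 2)).differentiableAt

theorem differentiableAt_theta4 (x : ℝ) {t : ℝ} (ht : 0 < t) :
    DifferentiableAt ℝ (theta4 · t) x :=
  ((differentiableAt_theta3 (x + 1 / 2) ht).hasDerivAt.comp_add_const x (1 / 2)).differentiableAt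

theorem continuous_theta1 {t : ℝ} (ht : 0 < t) : Continuous (theta1 · t) :=
  continuous_iff_continuousAt.2 fun x => (differentiableAt_theta1 x ht).continuousAt

theorem continuous_theta4 {t : ℝ} (ht : 0 < t) : Continuous (theta4 · t) :=
  continuous_iff_continuousAt.2 fun x => (differentiableAt_theta4 x ht).continuousAt

theorem hasDerivAt_theta1_zero {t : ℝ} (ht : 0 < t) :
    HasDerivAt (theta1 · t) (theta1Deriv t) 0 := by
  have h := (differentiableAt_theta2 (0 - 1 / 2) ht).hasDerivAt.comp_sub_const 0 (1 / 2)
  rw [zero_sub] at h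
  exact h

/-! ### Positivity of `θ₁` on `(0, 1)` -/

theorem abs_sin_nat_mul_le (n : ℕ) (x : ℝ) : |Real.sin (n * x)| ≤ n * |Real.sin x| := by
  induction n with
  | zero => simp
  | succ n ih =>
    push_cast
    rw [add_mul, one_mul, Real.sin_add]
    refine (abs_add_le _ _).trans ?_
    rw [abs_mul, abs_mul, add_mul, one_mul]
    exact add_le_add ((mul_le_of_le_one_right (abs_nonneg _) (Real.abs_cos_le_one x)).trans ih)
      (mul_le_of_le_one_left (abs_nonneg _) (Real.abs_cos_le_one _))

theorem cos_half_integer_mul_sub_half (n : ℕ) (x : ℝ) :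
    Real.cos (2 * π * (n + 1 / 2) * (x - 1 / 2)) = (-1) ^ n * Real.sin ((2 * n + 1) * (π * x)) := by
  have : 2 * π * (n + 1 / 2) * (x - 1 / 2) = (2 * n + 1) * (π * x) - π / 2 - n * π := by ring
  rw [this, Real.cos_sub_nat_mul_pi, Real.cos_sub_pi_div_two]

theorem theta1_pos_of_one_le {t : ℝ} (ht : 1 ≤ t) {x : ℝ} (hx : x ∈ Set.Ioo (0 : ℝ) 1) :
    0 < theta1 x t := by
  have hs : 0 < Real.sin (π * x) := Real.sin_pos_of_pos_of_lt_pi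
    (mul_pos Real.pi_pos hx.1) (by nlinarith [hx.2, Real.pi_pos])
  have hsum := hasSum_theta2 (x - 1 / 2) (lt_of_lt_of_le one_pos ht)
  set f : ℕ → ℝ := fun n => 2 * Real.cos (2 * π * (n + 1 / 2) * (x - 1 / 2)) *
    Real.exp (-π * (n + 1 / 2) ^ 2 * t) with hf
  set c := 2 * Real.sin (π * x) * Real.exp (-π * (1 / 2) ^ 2 * t) with hc
  have hc0 : 0 < c := by positivity
  have hf0 : f 0 = c := by
    simp only [hf, cos_half_integer_mul_sub_half, hc]
    simp
  have hexp : Real.exp (-π * 2 * t) ≤ 1 / 12 := by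
    have h1 : Real.exp (-π * 2 * t) ≤ Real.exp (-6) := by
      apply Real.exp_le_exp.2
      nlinarith [Real.pi_gt_three]
    have h2 : (12 : ℝ) ≤ Real.exp 6 := by
      have := Real.add_one_le_exp (3 : ℝ)
      have h6 : Real.exp 6 = Real.exp 3 * Real.exp 3 := by rw [← Real.exp_add]; norm_num
      nlinarith
    rw [Real.exp_neg] at h1
    refine h1.trans ?_
    rw [one_div]
    exact inv_anti₀ (by norm_num) h2
  have hbound (n : ℕ) : ‖f (n + 1)‖ ≤ c * (1 / 4) * (1 / 4) ^ n := by
    have h1 : |Real.sin ((2 * ((n + 1 : ℕ) : ℝ) + 1) * (π * x))| ≤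
        3 ^ (n + 1) * Real.sin (π * x) := by
      have h := abs_sin_nat_mul_le (2 * (n + 1) + 1) (π * x)
      rw [abs_of_pos hs] at h
      push_cast at h ⊢
      refine h.trans (mul_le_mul_of_nonneg_right ?_ hs.le)
      have := one_add_mul_le_pow (show (-2 : ℝ) ≤ 2 by norm_num) (n + 1)
      norm_num at this ⊢
      linarith
    have h2 : Real.exp (-π * (((n + 1 : ℕ) : ℝ) + 1 / 2) ^ 2 * t) ≤
        Real.exp (-π * (1 / 2) ^ 2 * t) * (1 / 12) ^ (n + 1) := by
      have : Real.exp (-π * (((n + 1 : ℕ) : ℝ) + 1 / 2) ^ 2 * t) ≤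
          Real.exp (-π * (1 / 2) ^ 2 * t) * Real.exp (-π * 2 * t) ^ (n + 1) := by
        rw [← Real.exp_nat_mul, ← Real.exp_add]
        apply Real.exp_le_exp.2
        push_cast
        have : 0 ≤ π * t * (n * (n + 1)) := by positivity
        linarith
      refine this.trans ?_
      gcongr
    rw [Real.norm_eq_abs, hf]
    simp only [cos_half_integer_mul_sub_half]
    rw [abs_mul, abs_mul, abs_mul, abs_pow, abs_neg, abs_one, one_pow, one_mul, Real.abs_exp,
      abs_two]
    calc _ ≤ 2 * (3 ^ (n + 1) * Real.sin (π * x)) *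
          (Real.exp (-π * (1 / 2) ^ 2 * t) * (1 / 12) ^ (n + 1)) := by gcongr
      _ = c * (3 ^ (n + 1) * (1 / 12) ^ (n + 1)) := by rw [hc]; ring
      _ = c * (1 / 4) * (1 / 4) ^ n := by rw [← mul_pow]; norm_num; ring
  have hg : HasSum (fun n : ℕ => c * (1 / 4) * (1 / 4 : ℝ) ^ n) (c / 3) := by
    have := (hasSum_geometric_of_lt_one (r := 1 / 4) (by norm_num) (by norm_num)).mul_left
      (c * (1 / 4))
    rwa [show c * (1 / 4) * (1 - 1 / 4)⁻¹ = c / 3 by ring] at this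
  have htail := tsum_of_norm_bounded hg hbound
  have hsplit := hsum.summable.tsum_eq_zero_add
  rw [hsum.tsum_eq, hf0] at hsplit
  rw [theta1, hsplit]
  have := (abs_le.1 (Real.norm_eq_abs _ ▸ htail)).1
  linarith

theorem theta1_pos_of_forall_ne_zero {t : ℝ} (ht : 0 < t)
    (h : ∀ x ∈ Set.Ioo (0 : ℝ) 1, theta1 x t ≠ 0) {x : ℝ} (hx : x ∈ Set.Ioo (0 : ℝ) 1) :
    0 < theta1 x t := by
  by_contra! hneg
  have hhalf : 0 < theta1 (1 / 2) t := by
    rw [theta1_half]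
    exact theta2_zero_pos ht
  obtain ⟨y, hy, hy0⟩ := isPreconnected_Ioo.intermediate_value hx
    (show (1 / 2 : ℝ) ∈ Set.Ioo (0 : ℝ) 1 by norm_num)
    (continuous_theta1 ht).continuousOn ⟨hneg, hhalf.le⟩
  exact h y hy hy0

theorem theta1_pos_of_theta1_two_mul_pos {t : ℝ} (ht : 0 < t)
    (h : ∀ x ∈ Set.Ioo (0 : ℝ) 1, 0 < theta1 x (2 * t)) {x : ℝ} (hx : x ∈ Set.Ioo (0 : ℝ) 1) :
    0 < theta1 x t := by
  have hlt {y : ℝ} (hy : y ∈ Set.Ioo (0 : ℝ) (1 / 2)) : theta1 y t ≠ 0 := by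
    intro h0
    have h1 := theta1_mul_theta2_self y ht
    rw [h0, zero_mul] at h1
    exact (mul_pos (h (2 * y) ⟨by linarith [hy.1], by linarith [hy.2]⟩)
      (theta4_pos 0 (by positivity))).ne h1
  refine theta1_pos_of_forall_ne_zero ht (fun y hy => ?_) hx
  rcases lt_trichotomy y (1 / 2) with h1 | rfl | h1
  · exact hlt ⟨hy.1, h1⟩
  · rw [theta1_half]
    exact (theta2_zero_pos ht).ne'
  · rw [← theta1_one_sub]
    exact hlt ⟨by linarith [hy.2], by linarith⟩

theorem theta1_pos {t : ℝ} (ht : 0 < t) {x : ℝ} (hx : x ∈ Set.Ioo (0 : ℝ) 1) :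
    0 < theta1 x t := by
  obtain ⟨n, hn⟩ := pow_unbounded_of_one_lt (1 / t) (one_lt_two (α := ℝ))
  have hn' : 1 ≤ 2 ^ n * t := by
    rw [div_lt_iff₀ ht] at hn
    exact hn.le
  clear hn
  induction n generalizing t x with
  | zero => exact theta1_pos_of_one_le (by simpa using hn') hx
  | succ n ih =>
    refine theta1_pos_of_theta1_two_mul_pos ht (fun y hy => ih (by positivity) hy ?_) hx
    rw [← mul_assoc, ← pow_succ]
    exact hn'

theorem theta2_pos {t : ℝ} (ht : 0 < t) {x : ℝ} (hx : x ∈ Set.Ico (0 : ℝ) (1 / 2)) :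
    0 < theta2 x t := by
  have h := theta1_pos ht (x := x + 1 / 2) ⟨by linarith [hx.1], by linarith [hx.2]⟩
  simpa [theta1] using h

/-! ### The derivative of `θ₁ / θ₄` -/

theorem deriv_theta1_mul_theta4_sub {t : ℝ} (ht : 0 < t) {x : ℝ} (hx : x ∈ Set.Ioo (0 : ℝ) 1) :
    (deriv (theta1 · t) x * theta4 x t - theta1 x t * deriv (theta4 · t) x) *
      (theta2 0 t * theta3 0 t) = theta1Deriv t * theta4 0 t * (theta2 x t * theta3 x t) := by
  have h1 : HasDerivAt (fun y => theta1 (x + y) t) (deriv (theta1 · t) (x + x)) x :=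
    (differentiableAt_theta1 (x + x) ht).hasDerivAt.comp_const_add x x
  have h2 : HasDerivAt (fun y => theta1 (x - y) t) (-theta1Deriv t) x := by
    have h := hasDerivAt_theta1_zero ht
    rw [← sub_self x] at h
    exact h.comp_const_sub x x
  have h3 := (h1.mul h2).mul_const (theta4 0 t ^ 2)
  have d1 := (differentiableAt_theta1 x ht).hasDerivAt
  have d4 := (differentiableAt_theta4 x ht).hasDerivAt
  have h4 := ((d4.pow 2).const_mul (theta1 x t ^ 2)).sub ((d1.pow 2).const_mul (theta4 x t ^ 2))
  have h5 := h3.unique (h4.congr_of_eventuallyEq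
    (.of_forall fun y => theta1_add_mul_theta1_sub x y ht))
  have h6 := theta1_two_mul x ht
  rw [sub_self, theta1_zero, mul_zero, zero_add, ← two_mul] at h5
  simp only [Nat.cast_ofNat, Nat.add_one_sub_one, pow_one] at h5
  have hne : 2 * theta1 x t * theta4 x t * theta4 0 t ≠ 0 := by
    have := theta1_pos ht hx
    have := theta4_pos x ht
    have := theta4_pos 0 ht
    positivity
  apply mul_left_cancel₀ hne
  linear_combination (theta2 0 t * theta3 0 t * theta4 0 t) * h5 +
    theta1Deriv t * theta4 0 t ^ 2 * h6

/-! ### The elliptic integrals of the modulus attached to a nome -/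

/-- The modulus `θ₂² / θ₃²` belonging to the nome `exp (-π t)`. -/
noncomputable def thetaModulus (t : ℝ) : ℝ := theta2 0 t ^ 2 / theta3 0 t ^ 2

theorem thetaModulus_pos {t : ℝ} (ht : 0 < t) : 0 < thetaModulus t :=
  div_pos (pow_pos (theta2_zero_pos ht) 2) (pow_pos (theta3_pos 0 ht) 2)

theorem thetaModulus_one_div {t : ℝ} (ht : 0 < t) :
    thetaModulus (1 / t) = theta4 0 t ^ 2 / theta3 0 t ^ 2 := by
  have h : √t ≠ 0 := (Real.sqrt_pos.2 ht).ne'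
  rw [thetaModulus, theta2_zero_one_div ht, theta3_zero_one_div, theta4, zero_add, mul_pow, mul_pow,
    mul_div_mul_left _ _ (pow_ne_zero 2 h)]

theorem thetaModulus_sq_add {t : ℝ} (ht : 0 < t) :
    thetaModulus t ^ 2 + thetaModulus (1 / t) ^ 2 = 1 := by
  have h := (theta3_pos 0 ht).ne'
  rw [thetaModulus_one_div ht, thetaModulus]
  field_simp
  linear_combination -theta3_zero_pow_four ht

theorem sqrt_one_sub_thetaModulus_sq {t : ℝ} (ht : 0 < t) :
    √(1 - thetaModulus t ^ 2) = thetaModulus (1 / t) := by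
  rw [show 1 - thetaModulus t ^ 2 = thetaModulus (1 / t) ^ 2 by linarith [thetaModulus_sq_add ht]]
  exact Real.sqrt_sq (thetaModulus_pos (by positivity)).le

theorem thetaModulus_lt_one {t : ℝ} (ht : 0 < t) : thetaModulus t < 1 := by
  have h1 := thetaModulus_sq_add ht
  have h2 := thetaModulus_pos (t := 1 / t) (by positivity)
  nlinarith [thetaModulus_pos ht]

theorem thetaModulus_two_mul_le {t : ℝ} (ht : 0 < t) :
    thetaModulus (2 * t) ≤ thetaModulus t ^ 2 := by
  have h2t : 0 < 2 * t := by positivity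
  have h2 := theta2_mul_theta2 0 0 ht
  have h3 := theta3_mul_theta3 0 0 ht
  have hlt := thetaModulus_lt_one h2t
  simp only [thetaModulus, sub_self, add_zero, sq] at *
  rw [h2, h3]
  have ha := theta3_pos 0 h2t
  have hb := theta2_zero_pos h2t
  generalize theta3 0 (2 * t) = a at *
  generalize theta2 0 (2 * t) = b at *
  rw [div_lt_one (by positivity)] at hlt
  rw [div_mul_div_comm, div_le_div_iff₀ (by positivity) (by positivity)]
  have h : (a * a + b * b) * (a * a + b * b) ≤ (2 * (a * a)) * (2 * (a * a)) := by
    gcongr <;> linarith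
  nlinarith [mul_le_mul_of_nonneg_left h (mul_pos hb hb).le]

theorem continuousOn_thetaModulus : ContinuousOn thetaModulus (Set.Ioi 0) := by
  have h3 : ContinuousOn (theta3 0) (Set.Ioi 0) :=
    HurwitzZeta.continuousOn_cosKernel ((0 : ℝ) : UnitAddCircle)
  have h2 : ContinuousOn (theta2 0) (Set.Ioi 0) :=
    (HurwitzZeta.continuousOn_evenKernel ((1 / 2 : ℝ) : UnitAddCircle)).congr
      fun t ht => theta2_zero_eq_evenKernel ht
  exact (h2.pow 2).div (h3.pow 2) fun t ht => (pow_pos (theta3_pos 0 ht) 2).ne'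

theorem exists_thetaModulus_lt {ε : ℝ} (hε : 0 < ε) : ∃ t > 0, thetaModulus t < ε := by
  have h1 := thetaModulus_lt_one one_pos
  have h0 := thetaModulus_pos one_pos
  obtain ⟨n, hn⟩ := exists_pow_lt_of_lt_one hε h1
  have hle (n : ℕ) : thetaModulus (2 ^ n) ≤ thetaModulus 1 ^ (n + 1) := by
    induction n with
    | zero => simp
    | succ n ih =>
      rw [pow_succ']
      refine (thetaModulus_two_mul_le (by positivity)).trans
        ((pow_le_pow_left₀ (thetaModulus_pos (by positivity)).le ih 2).trans ?_)
      rw [← pow_mul]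
      exact pow_le_pow_of_le_one h0.le h1.le (by omega)
  exact ⟨2 ^ n, by positivity, ((hle n).trans
    (pow_le_pow_of_le_one h0.le h1.le (Nat.le_succ n))).trans_lt hn⟩

theorem exists_thetaModulus_eq {k : ℝ} (hk : k ∈ Set.Ioo (0 : ℝ) 1) :
    ∃ t > 0, thetaModulus t = k := by
  obtain ⟨a, ha, hak⟩ := exists_thetaModulus_lt hk.1
  obtain ⟨b, hb, hbk⟩ := exists_thetaModulus_lt (ε := √(1 - k ^ 2))
    (Real.sqrt_pos.2 (by nlinarith [hk.1, hk.2]))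
  have hb' : 0 < 1 / b := one_div_pos.2 hb
  have hbk' : k ≤ thetaModulus (1 / b) := by
    have h := thetaModulus_sq_add hb
    have h1 := Real.lt_sqrt (thetaModulus_pos hb).le |>.1 hbk
    exact le_of_sq_le_sq (by linarith) (thetaModulus_pos hb').le
  exact isPreconnected_Ioi.intermediate_value ha hb' continuousOn_thetaModulus ⟨hak.le, hbk'⟩

theorem EllK_thetaModulus {t : ℝ} (ht : 0 < t) :
    EllK (thetaModulus t) =
      theta1Deriv t * theta3 0 t / (2 * theta2 0 t * theta4 0 t) := by
  have p2 := theta2_zero_pos ht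
  have p3 := theta3_pos 0 ht
  have p4 := theta4_pos 0 ht
  have q4 (x : ℝ) := theta4_pos x ht
  set s : ℝ → ℝ := fun x => theta3 0 t / theta2 0 t * (theta1 x t / theta4 x t) with hs
  have hscont : Continuous s :=
    continuous_const.mul ((continuous_theta1 ht).div (continuous_theta4 ht) fun x => (q4 x).ne')
  set g : ℝ → ℝ := fun θ => 1 / √(1 - thetaModulus t ^ 2 * Real.sin θ ^ 2) with hg
  have hgcont : Continuous g := by
    refine continuous_const.div (by fun_prop) fun θ => ?_
    refine (Real.sqrt_pos.2 ?_).ne'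
    have h1 := Real.sin_sq_le_one θ
    have h2 := thetaModulus_lt_one ht
    have h3 := thetaModulus_pos ht
    have : thetaModulus t ^ 2 < 1 := by nlinarith
    nlinarith [sq_nonneg (Real.sin θ)]
  set f' : ℝ → ℝ := fun x => theta1Deriv t / theta2 0 t * (theta3 x t / theta4 x t) with hf'
  have hf'cont : Continuous f' :=
    continuous_const.mul ((continuous_theta3 ht).div (continuous_theta4 ht) fun x => (q4 x).ne')
  have hcos (x : ℝ) : 1 - s x ^ 2 = (theta4 0 t / theta2 0 t * (theta2 x t / theta4 x t)) ^ 2 := by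
    have := (q4 x).ne'
    simp only [hs]
    field_simp
    linear_combination -theta2_sq x ht
  have hdelta (x : ℝ) : 1 - thetaModulus t ^ 2 * s x ^ 2 =
      (theta4 0 t / theta3 0 t * (theta3 x t / theta4 x t)) ^ 2 := by
    have := (q4 x).ne'
    simp only [hs, thetaModulus]
    field_simp
    linear_combination -theta3_sq x ht
  have hsle (x : ℝ) : s x ^ 2 ≤ 1 := by nlinarith [hcos x]
  have hderiv : ∀ x ∈ Set.Ioo (0 : ℝ) (1 / 2),
      HasDerivAt (fun x => Real.arcsin (s x)) (f' x) x := by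
    intro x hx
    have hx4 := q4 x
    have hx2 := theta2_pos ht ⟨hx.1.le, hx.2⟩
    have hc : 0 < theta4 0 t / theta2 0 t * (theta2 x t / theta4 x t) := by positivity
    have hlt : s x ^ 2 < 1 := by nlinarith [hcos x]
    have hsd : HasDerivAt s (theta3 0 t / theta2 0 t *
        ((deriv (theta1 · t) x * theta4 x t - theta1 x t * deriv (theta4 · t) x) /
          theta4 x t ^ 2)) x :=
      ((differentiableAt_theta1 x ht).hasDerivAt.div
        (differentiableAt_theta4 x ht).hasDerivAt hx4.ne').const_mul _
    have habs := abs_lt.1 ((sq_lt_one_iff_abs_lt_one _).1 hlt)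
    have ha := (Real.hasDerivAt_arcsin habs.1.ne' habs.2.ne).comp x hsd
    refine ha.congr_deriv ?_
    rw [hcos, Real.sqrt_sq hc.le, eq_div_of_mul_eq (mul_pos p2 p3).ne'
      (deriv_theta1_mul_theta4_sub ht ⟨hx.1, by linarith [hx.2]⟩)]
    simp only [hf']
    field_simp
  have hconst : ∀ x, (g ∘ fun x => Real.arcsin (s x)) x * f' x =
      theta1Deriv t * theta3 0 t / (theta2 0 t * theta4 0 t) := by
    intro x
    have hx4 := q4 x
    have hx3 := theta3_pos x ht
    have habs := abs_le.1 ((sq_le_one_iff_abs_le_one _).1 (hsle x))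
    simp only [Function.comp, hg, hf', Real.sin_arcsin habs.1 habs.2, hdelta]
    rw [Real.sqrt_sq (by positivity)]
    field_simp
  have hsub := intervalIntegral.integral_comp_mul_deriv'' (a := 0) (b := 1 / 2)
    (f := fun x => Real.arcsin (s x)) (f' := f') (g := g)
    (Real.continuous_arcsin.comp hscont).continuousOn
    (fun x hx => (hderiv x (by simpa using hx)).hasDerivWithinAt)
    hf'cont.continuousOn hgcont.continuousOn
  have hs0 : s 0 = 0 := by simp [hs, theta1_zero]
  have hs1 : s (1 / 2) = 1 := by
    simp only [hs, theta1_half, theta4_half]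
    field_simp
  simp only [hconst, hs0, hs1, Real.arcsin_zero, Real.arcsin_one,
    intervalIntegral.integral_const] at hsub
  rw [EllK, ← hsub, smul_eq_mul]
  field_simp
  norm_num

theorem EllK_thetaModulus_one_div {t : ℝ} (ht : 0 < t) :
    EllK (thetaModulus (1 / t)) = t * EllK (thetaModulus t) := by
  rw [EllK_thetaModulus ht, EllK_thetaModulus (by positivity), theta1Deriv_one_div ht,
    theta3_zero_one_div, theta2_zero_one_div ht, theta4, zero_add, theta3_half_one_div ht, theta4,
    zero_add]
  have := (theta2_zero_pos ht).ne'
  have := (theta3_pos (1 / 2) ht).ne'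
  have := (Real.sqrt_pos.2 ht).ne'
  field_simp

theorem nome_thetaModulus {t : ℝ} (ht : 0 < t) (hK : EllK (thetaModulus t) ≠ 0) :
    nome (thetaModulus t) = Real.exp (-π * t) := by
  rw [nome, EllK', sqrt_one_sub_thetaModulus_sq ht, EllK_thetaModulus_one_div ht]
  congr 1
  field_simp

/-! ### The Jacobi functions in terms of the real theta functions -/

section JacobiFunctions

variable {t k : ℝ}

theorem JTheta1_eq (ht : 0 < t) (hq : nome k = Real.exp (-π * t)) (u : ℝ) :
    JTheta1 u k = theta3 (u / (2 * EllK k)) t := by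
  have h := hasSum_theta3 (u / (2 * EllK k)) ht
  rw [JTheta1, ← eq_sub_iff_add_eq', ← h.tsum_eq, ← tsum_mul_left]
  congr 1 with n
  rw [hq, ← Real.exp_nat_mul]
  push_cast
  ring_nf

theorem JTheta_eq (ht : 0 < t) (hq : nome k = Real.exp (-π * t)) (u : ℝ) :
    JTheta u k = theta4 (u / (2 * EllK k)) t := by
  have h := hasSum_theta3 (u / (2 * EllK k) + 1 / 2) ht
  rw [JTheta, theta4, ← eq_sub_iff_add_eq', ← h.tsum_eq, ← tsum_mul_left]
  congr 1 with n
  have e : 2 * π * (u / (2 * EllK k) + 1 / 2) * (n + 1) =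
      (n + 1) * π * u / EllK k + (n + 1 : ℕ) * π := by push_cast; ring
  rw [hq, ← Real.exp_nat_mul, e, Real.cos_add_nat_mul_pi]
  push_cast
  ring_nf

theorem JH1_eq (hq : nome k = Real.exp (-π * t)) (u : ℝ) :
    JH1 u k = theta2 (u / (2 * EllK k)) t := by
  rw [JH1, theta2, ← tsum_mul_left]
  congr 1 with n
  rw [hq, ← Real.exp_mul]
  ring_nf

theorem JH_eq (hq : nome k = Real.exp (-π * t)) (u : ℝ) :
    JH u k = theta1 (u / (2 * EllK k)) t := by
  rw [JH, theta1, theta2, ← tsum_mul_left]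
  congr 1 with n
  rw [hq, ← Real.exp_mul, cos_half_integer_mul_sub_half]
  ring_nf

end JacobiFunctions

theorem deriv_theta1_add_mul_theta1_sub (x y : ℝ) {t : ℝ} (ht : 0 < t) :
    (deriv (theta1 · t) (x + y) * theta1 (x - y) t +
        theta1 (x + y) t * deriv (theta1 · t) (x - y)) * theta4 0 t ^ 2 =
      2 * theta1 x t * deriv (theta1 · t) x * theta4 y t ^ 2 -
        2 * theta4 x t * deriv (theta4 · t) x * theta1 y t ^ 2 := by
  have h1 := (differentiableAt_theta1 (x + y) ht).hasDerivAt.comp_add_const x y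
  have h2 := (differentiableAt_theta1 (x - y) ht).hasDerivAt.comp_sub_const x y
  have d1 := (differentiableAt_theta1 x ht).hasDerivAt
  have d4 := (differentiableAt_theta4 x ht).hasDerivAt
  have h := ((h1.mul h2).mul_const (theta4 0 t ^ 2)).unique
    ((((d1.pow 2).mul_const (theta4 y t ^ 2)).sub
      ((d4.pow 2).mul_const (theta1 y t ^ 2))).congr_of_eventuallyEq
        (.of_forall fun x => theta1_add_mul_theta1_sub x y ht))
  simpa using h

theorem deriv_log_theta1_sub_div_theta1_add {t K u v : ℝ} (ht : 0 < t)
    (hsub : 0 < theta1 (v / K - u / K) t) (hadd : 0 < theta1 (v / K + u / K) t) :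
    deriv (fun w => Real.log (theta1 ((v - w) / K) t / theta1 ((v + w) / K) t)) u =
      -(1 / K) * (deriv (theta1 · t) (v / K - u / K) / theta1 (v / K - u / K) t +
        deriv (theta1 · t) (v / K + u / K) / theta1 (v / K + u / K) t) := by
  rw [← sub_div] at *
  rw [← add_div] at *
  have h1 : HasDerivAt (fun w => theta1 ((v - w) / K) t)
      (deriv (theta1 · t) ((v - u) / K) * (-1 / K)) u :=
    HasDerivAt.comp (h₂ := (theta1 · t)) u (differentiableAt_theta1 _ ht).hasDerivAt
      (((hasDerivAt_id u).const_sub v).div_const K)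
  have h2 : HasDerivAt (fun w => theta1 ((v + w) / K) t)
      (deriv (theta1 · t) ((v + u) / K) * (1 / K)) u :=
    HasDerivAt.comp (h₂ := (theta1 · t)) u (differentiableAt_theta1 _ ht).hasDerivAt
      (((hasDerivAt_id u).const_add v).div_const K)
  refine (((h1.div h2 hadd.ne').log (div_pos hsub hadd).ne').congr_deriv ?_).deriv
  simp only [Pi.div_apply]
  field_simp
  ring

theorem sn_mul_cn_mul_dn {k : ℝ} (hk : 0 < k) (v : ℝ) :
    sn v k * cn v k * dn v k =
      √(1 - k ^ 2) / k * (JH v k * JH1 v k * JTheta1 v k / JTheta v k ^ 3) := by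
  have hk' : √(1 - k ^ 2) / k = √√(1 - k ^ 2) ^ 2 / √k ^ 2 := by
    rw [Real.sq_sqrt hk.le, Real.sq_sqrt (Real.sqrt_nonneg _)]
  rw [hk', sn, cn, dn, Real.sqrt_div (Real.sqrt_nonneg _)]
  ring

theorem sn_sq {k : ℝ} (hk : 0 < k) (v : ℝ) : sn v k ^ 2 = JH v k ^ 2 / (k * JTheta v k ^ 2) := by
  rw [sn, div_pow, mul_pow, Real.sq_sqrt hk.le]

theorem deriv_theta1_mul_theta4_sub_eq_EllK {t : ℝ} (ht : 0 < t) {x : ℝ}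
    (hx : x ∈ Set.Ioo (0 : ℝ) 1) :
    deriv (theta1 · t) x * theta4 x t - theta1 x t * deriv (theta4 · t) x =
      2 * EllK (thetaModulus t) * thetaModulus (1 / t) * (theta2 x t * theta3 x t) := by
  have p2 := theta2_zero_pos ht
  have p3 := theta3_pos 0 ht
  have p4 := theta4_pos 0 ht
  rw [EllK_thetaModulus ht, thetaModulus_one_div ht,
    eq_div_of_mul_eq (mul_pos p2 p3).ne' (deriv_theta1_mul_theta4_sub ht hx)]
  field_simp

theorem stmt_16 (k u v : ℝ) (hk : k ∈ Set.Ioo (0:ℝ) 1)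
    (hu : u ∈ Set.Ioo (0:ℝ) (EllK k)) (hv : v ∈ Set.Ioo (0:ℝ) (EllK k)) (huv : u < v) :
    deriv (fun w => Real.log (JH (v - w) k / JH (v + w) k)) u =
      2 * sn v k * cn v k * dn v k / (sn u k ^ 2 - sn v k ^ 2) - 2 * zn v k := by
  obtain ⟨t, ht, rfl⟩ := exists_thetaModulus_eq hk
  have hK : 0 < EllK (thetaModulus t) := hu.1.trans hu.2
  have hq := nome_thetaModulus ht hK.ne'
  have hzn : zn v (thetaModulus t) = 1 / (2 * EllK (thetaModulus t)) *
      deriv (theta4 · t) (v / (2 * EllK (thetaModulus t))) /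
        theta4 (v / (2 * EllK (thetaModulus t))) t := by
    rw [zn, JTheta_eq ht hq]
    simp only [JTheta_eq ht hq]
    congr 1
    exact (HasDerivAt.comp (h₂ := (theta4 · t)) v (differentiableAt_theta4 _ ht).hasDerivAt
      ((hasDerivAt_id v).div_const (2 * EllK (thetaModulus t)))).deriv.trans (mul_comm _ _)
  rw [hzn, mul_assoc, mul_assoc, ← mul_assoc (sn _ _), sn_mul_cn_mul_dn hk.1, sn_sq hk.1,
    sn_sq hk.1, sqrt_one_sub_thetaModulus_sq ht]
  simp only [JTheta_eq ht hq, JH_eq hq, JH1_eq hq, JTheta1_eq ht hq]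
  have hx : v / (2 * EllK (thetaModulus t)) < 1 / 2 := by
    rw [div_lt_iff₀ (by positivity)]
    linarith [hv.2]
  have hxy : u / (2 * EllK (thetaModulus t)) < v / (2 * EllK (thetaModulus t)) :=
    div_lt_div_of_pos_right huv (by positivity)
  have hy : 0 < u / (2 * EllK (thetaModulus t)) := div_pos hu.1 (by positivity)
  have hsub := theta1_pos ht
    (x := v / (2 * EllK (thetaModulus t)) - u / (2 * EllK (thetaModulus t)))
    ⟨by linarith, by linarith⟩
  have hadd := theta1_pos ht
    (x := v / (2 * EllK (thetaModulus t)) + u / (2 * EllK (thetaModulus t)))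
    ⟨by linarith, by linarith⟩
  rw [deriv_log_theta1_sub_div_theta1_add ht hsub hadd]
  generalize v / (2 * EllK (thetaModulus t)) = x at *
  generalize u / (2 * EllK (thetaModulus t)) = y at *
  have hW := deriv_theta1_mul_theta4_sub_eq_EllK ht (x := x) ⟨by linarith, by linarith⟩
  have hD := deriv_theta1_add_mul_theta1_sub x y ht
  have hA := theta1_add_mul_theta1_sub x y ht
  have hk0 := thetaModulus_pos ht
  have p4 := theta4_pos 0 ht
  have p4x := theta4_pos x ht
  have p4y := theta4_pos y ht
  have hden : theta1 y t ^ 2 / (thetaModulus t * theta4 y t ^ 2) -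
      theta1 x t ^ 2 / (thetaModulus t * theta4 x t ^ 2) =
      -(theta1 (x + y) t * theta1 (x - y) t * theta4 0 t ^ 2) /
        (thetaModulus t * theta4 x t ^ 2 * theta4 y t ^ 2) := by
    field_simp
    linear_combination hA
  rw [hden]
  generalize EllK (thetaModulus t) = K at *
  field_simp
  linear_combination -theta4 x t * hD - 2 * theta1 x t * theta4 y t ^ 2 * hW +
    2 * deriv (theta4 · t) x * hA
end

section
/- Let k ∈ (0,1). Then the function g(u) := dn²(u,k) + zn²(u,k) is strictly monotone decreasing on the interval (0, K(k)). -/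
open Real

section

open Complex HurwitzZeta

/-- The even-index half of the theta series at half the modulus. -/
noncomputable def thetaEven (τ z : ℂ) : ℂ := jacobiTheta₂ (2 * z) (2 * τ)

/-- The odd-index half of the theta series at half the modulus. -/
noncomputable def thetaOdd (τ z : ℂ) : ℂ :=
  cexp (π * I * τ / 2 + 2 * π * I * z) * jacobiTheta₂ (2 * z + τ) (2 * τ)

/-- Pairs of integers, classified by the parity of their sum. -/
def sumDiffMap : (ℤ × ℤ) ⊕ (ℤ × ℤ) → ℤ × ℤ :=
  Sum.elim (fun p => (p.1 + p.2, p.1 - p.2)) (fun p => (p.1 + p.2 + 1, p.1 - p.2))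

lemma sumDiffMap_bijective : Function.Bijective sumDiffMap := by
  constructor
  · rintro (⟨a, b⟩ | ⟨a, b⟩) (⟨c, d⟩ | ⟨c, d⟩) h <;>
      simp only [sumDiffMap, Sum.elim_inl, Sum.elim_inr, Prod.mk.injEq] at h <;> grind
  · rintro ⟨m, n⟩
    rcases Int.even_or_odd' (m + n) with ⟨c, hc | hc⟩
    · exact ⟨.inl (c, m - c), by simp only [sumDiffMap, Sum.elim_inl, Prod.mk.injEq]; omega⟩
    · exact ⟨.inr (c, m - c - 1), by simp only [sumDiffMap, Sum.elim_inr, Prod.mk.injEq]; omega⟩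

lemma summable_norm_term (z : ℂ) {τ : ℂ} (hτ : 0 < τ.im) :
    Summable fun n : ℤ => ‖jacobiTheta₂_term n z τ‖ :=
  ((summable_jacobiTheta₂_term_iff z τ).2 hτ).norm

lemma summable_term_mul_term (a b : ℂ) {τ : ℂ} (hτ : 0 < τ.im) :
    Summable fun p : ℤ × ℤ => jacobiTheta₂_term p.1 a τ * jacobiTheta₂_term p.2 b τ :=
  summable_mul_of_summable_norm (f := fun n => jacobiTheta₂_term n a τ)
    (g := fun n => jacobiTheta₂_term n b τ) (summable_norm_term a hτ) (summable_norm_term b hτ)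

lemma hasSum_term_mul_term (a b : ℂ) {τ : ℂ} (hτ : 0 < τ.im) :
    HasSum (fun p : ℤ × ℤ => jacobiTheta₂_term p.1 a τ * jacobiTheta₂_term p.2 b τ)
      (jacobiTheta₂ a τ * jacobiTheta₂ b τ) := by
  rw [jacobiTheta₂, jacobiTheta₂,
    tsum_mul_tsum_of_summable_norm (f := fun n => jacobiTheta₂_term n a τ)
      (g := fun n => jacobiTheta₂_term n b τ) (summable_norm_term a hτ) (summable_norm_term b hτ)]
  exact (summable_term_mul_term a b hτ).hasSum

/-- The addition formula for theta functions. -/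
lemma jacobiTheta₂_add_mul_sub {τ : ℂ} (hτ : 0 < τ.im) (z w : ℂ) :
    jacobiTheta₂ (z + w) τ * jacobiTheta₂ (z - w) τ =
      thetaEven τ z * thetaEven τ w + thetaOdd τ z * thetaOdd τ w := by
  have h2 : 0 < (2 * τ).im := by simpa using hτ
  have h1 := (Equiv.ofBijective _ sumDiffMap_bijective).hasSum_iff.2
    (hasSum_term_mul_term (z + w) (z - w) hτ)
  refine h1.unique (HasSum.sum ?_ ?_)
  · refine (congrArg (HasSum · _) (funext fun p => ?_)).mpr
      (hasSum_term_mul_term (2 * z) (2 * w) h2)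
    simp only [Function.comp_apply, Equiv.ofBijective_apply, sumDiffMap, Sum.elim_inl,
      jacobiTheta₂_term, ← Complex.exp_add]
    push_cast
    ring_nf
  · have := (hasSum_term_mul_term (2 * z + τ) (2 * w + τ) h2).mul_left
      (cexp (π * I * τ / 2 + 2 * π * I * z) * cexp (π * I * τ / 2 + 2 * π * I * w))
    rw [thetaOdd, thetaOdd, mul_mul_mul_comm]
    refine (congrArg (HasSum · _) (funext fun p => ?_)).mpr this
    simp only [Function.comp_apply, Equiv.ofBijective_apply, sumDiffMap, Sum.elim_inr,
      jacobiTheta₂_term, ← Complex.exp_add]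
    push_cast
    ring_nf

lemma thetaEven_add_half (τ z : ℂ) : thetaEven τ (z + 1 / 2) = thetaEven τ z := by
  rw [thetaEven, mul_add, mul_one_div_cancel two_ne_zero, jacobiTheta₂_add_left, thetaEven]

lemma thetaOdd_add_half (τ z : ℂ) : thetaOdd τ (z + 1 / 2) = -thetaOdd τ z := by
  have h1 : 2 * (z + 1 / 2) + τ = 2 * z + τ + 1 := by ring
  have h2 : π * I * τ / 2 + 2 * π * I * (z + 1 / 2) = π * I * τ / 2 + 2 * π * I * z + π * I := by
    ring
  rw [thetaOdd, h1, jacobiTheta₂_add_left, h2, Complex.exp_add, exp_pi_mul_I, thetaOdd]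
  ring

lemma thetaOdd_neg (τ z : ℂ) : thetaOdd τ (-z) = thetaOdd τ z := by
  have h1 : 2 * -z + τ = -(2 * z - τ) := by ring
  have h2 : 2 * z + τ = 2 * z - τ + 2 * τ := by ring
  rw [thetaOdd, thetaOdd, h1, jacobiTheta₂_neg_left, h2, jacobiTheta₂_add_left', ← mul_assoc,
    ← Complex.exp_add]
  ring_nf

lemma thetaOdd_quarter (τ : ℂ) : thetaOdd τ (1 / 4) = 0 := by
  have h := thetaOdd_add_half τ (-(1 / 4))
  rw [thetaOdd_neg, show (-(1 / 4) + 1 / 2 : ℂ) = 1 / 4 by norm_num] at h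
  exact self_eq_neg.1 h

/-- The duplication formula for the product of two theta functions. -/
lemma jacobiTheta₂_mul_add_half {τ : ℂ} (hτ : 0 < τ.im) (z : ℂ) :
    jacobiTheta₂ z τ * jacobiTheta₂ (z + 1 / 2) τ =
      jacobiTheta₂ (2 * z + 1 / 2) (2 * τ) * jacobiTheta₂ (1 / 2) (2 * τ) := by
  have h := jacobiTheta₂_add_mul_sub hτ (z + 1 / 4) (1 / 4)
  rw [thetaOdd_quarter, mul_zero, add_zero, thetaEven, thetaEven] at h
  rw [mul_comm, show z + 1 / 2 = z + 1 / 4 + 1 / 4 by ring,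
    show 2 * z + 1 / 2 = 2 * (z + 1 / 4) by ring, show (1 / 2 : ℂ) = 2 * (1 / 4) by norm_num, ← h]
  ring_nf

lemma jacobiTheta₂_add_mul_sub_half {τ : ℂ} (hτ : 0 < τ.im) (z w : ℂ) :
    jacobiTheta₂ (z + w + 1 / 2) τ * jacobiTheta₂ (z - w + 1 / 2) τ =
      thetaEven τ z * thetaEven τ w - thetaOdd τ z * thetaOdd τ w := by
  have h := jacobiTheta₂_add_mul_sub hτ (z + 1 / 2) w
  rw [thetaEven_add_half, thetaOdd_add_half] at h
  rw [show z + w + 1 / 2 = z + 1 / 2 + w by ring, show z - w + 1 / 2 = z + 1 / 2 - w by ring, h]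
  ring

lemma differentiable_jacobiTheta₂ {τ : ℂ} (hτ : 0 < τ.im) :
    Differentiable ℂ fun z => jacobiTheta₂ z τ :=
  fun z => differentiableAt_jacobiTheta₂_fst z hτ

lemma differentiable_thetaEven {τ : ℂ} (hτ : 0 < τ.im) : Differentiable ℂ (thetaEven τ) :=
  (differentiable_jacobiTheta₂ (τ := 2 * τ) (by simpa using hτ)).comp
    (differentiable_id.const_mul 2)

lemma differentiable_thetaOdd {τ : ℂ} (hτ : 0 < τ.im) : Differentiable ℂ (thetaOdd τ) := by
  refine Differentiable.mul (by fun_prop) ?_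
  exact (differentiable_jacobiTheta₂ (τ := 2 * τ) (by simpa using hτ)).comp
    ((differentiable_id.const_mul 2).add_const τ)

lemma differentiable_deriv_of_complex {f : ℂ → ℂ} (hf : Differentiable ℂ f) :
    Differentiable ℂ (deriv f) :=
  fun z => (hf.analyticAt z).deriv.differentiableAt

/-- The second derivative at the origin of `w ↦ f (z + w) f (z - w)`. -/
lemma deriv_deriv_add_mul_sub {f : ℂ → ℂ} (hf : Differentiable ℂ f) (z : ℂ) :
    deriv (deriv fun w => f (z + w) * f (z - w)) 0 =
      2 * (deriv (deriv f) z * f z - deriv f z ^ 2) := by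
  have hf' := differentiable_deriv_of_complex hf
  have hp : ∀ {g : ℂ → ℂ}, Differentiable ℂ g → ∀ w,
      HasDerivAt (fun w => g (z + w)) (deriv g (z + w)) w := fun hg w => by
    exact (hg (z + w)).hasDerivAt.comp_const_add z w
  have hm : ∀ {g : ℂ → ℂ}, Differentiable ℂ g → ∀ w,
      HasDerivAt (fun w => g (z - w)) (-deriv g (z - w)) w := fun hg w => by
    exact (hg (z - w)).hasDerivAt.comp_const_sub z w
  have h1 : (deriv fun w => f (z + w) * f (z - w)) =
      fun w => deriv f (z + w) * f (z - w) + f (z + w) * -deriv f (z - w) :=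
    funext fun w => ((hp hf w).mul (hm hf w)).deriv
  rw [h1]
  refine (((hp hf' 0).mul (hm hf 0)).add ((hp hf 0).mul (hm hf' 0).neg)).deriv.trans ?_
  simp only [Pi.neg_apply, add_zero, sub_zero]
  ring

/-- The logarithmic second derivative of a theta function is affine in the squared quotient of
two theta functions. -/
lemma exists_theta_wronskian {τ : ℂ} (hτ : 0 < τ.im) (hE : thetaEven τ 0 ≠ 0)
    (hO : thetaOdd τ 0 ≠ 0) :
    ∃ b c : ℂ, ∀ z, deriv (deriv fun z => jacobiTheta₂ z τ) z * jacobiTheta₂ z τ -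
      deriv (fun z => jacobiTheta₂ z τ) z ^ 2 =
        b * jacobiTheta₂ (z + 1 / 2) τ ^ 2 - c * jacobiTheta₂ z τ ^ 2 := by
  set P := thetaEven τ
  set Q := thetaOdd τ
  have hP := differentiable_thetaEven hτ
  have hQ := differentiable_thetaOdd hτ
  refine ⟨(deriv (deriv P) 0 / P 0 - deriv (deriv Q) 0 / Q 0) / 4,
    -(deriv (deriv P) 0 / P 0 + deriv (deriv Q) 0 / Q 0) / 4, fun z => ?_⟩
  have h1 := deriv_deriv_add_mul_sub (differentiable_jacobiTheta₂ hτ) z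
  have h2 : (fun w => jacobiTheta₂ (z + w) τ * jacobiTheta₂ (z - w) τ) =
      fun w => P z * P w + Q z * Q w := funext fun w => jacobiTheta₂_add_mul_sub hτ z w
  have h3 : (deriv fun w => P z * P w + Q z * Q w) =
      fun w => P z * deriv P w + Q z * deriv Q w := funext fun w =>
    (((hP w).hasDerivAt.const_mul _).add ((hQ w).hasDerivAt.const_mul _)).deriv
  have h4 := (((differentiable_deriv_of_complex hP 0).hasDerivAt.const_mul (P z)).add
    ((differentiable_deriv_of_complex hQ 0).hasDerivAt.const_mul (Q z))).deriv
  have h5 := jacobiTheta₂_add_mul_sub hτ z 0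
  have h6 := jacobiTheta₂_add_mul_sub_half hτ z 0
  simp only [add_zero, sub_zero] at h5 h6
  rw [h2, h3] at h1
  have h7 := h4.symm.trans h1
  rw [← mul_right_inj' (two_ne_zero' ℂ), ← h7, sq, sq, h5, h6]
  field_simp
  ring

/-- The theta series along the real axis. -/
noncomputable def thetaReal (t x : ℝ) : ℝ := (jacobiTheta₂ x (I * t)).re

/-- The theta series along the imaginary axis. -/
noncomputable def thetaImag (t y : ℝ) : ℝ := (jacobiTheta₂ (I * y) (I * t)).re

/-- The alternating theta series along the imaginary axis. -/
noncomputable def thetaAlt (t y : ℝ) : ℝ := (jacobiTheta₂ (I * y + 1 / 2) (I * t)).re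

lemma im_I_mul_ofReal_pos {t : ℝ} (ht : 0 < t) : 0 < (I * (t : ℂ)).im := by simpa using ht

lemma jacobiTheta₂_term_imag (n : ℤ) (t y : ℝ) :
    jacobiTheta₂_term n (I * y) (I * t) = (rexp (-π * t * n ^ 2 - 2 * π * n * y) : ℝ) := by
  rw [jacobiTheta₂_term, Complex.ofReal_exp]
  congr 1
  push_cast
  linear_combination (2 * π * n * y + π * n ^ 2 * t : ℂ) * I_sq

lemma jacobiTheta₂_term_add_half (n : ℤ) (z τ : ℂ) :
    jacobiTheta₂_term n (z + 1 / 2) τ = (-1) ^ n * jacobiTheta₂_term n z τ := by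
  rw [jacobiTheta₂_term, jacobiTheta₂_term,
    show 2 * π * I * n * (z + 1 / 2) + π * I * n ^ 2 * τ =
      n * (π * I) + (2 * π * I * n * z + π * I * n ^ 2 * τ) by ring,
    Complex.exp_add, Complex.exp_int_mul, exp_pi_mul_I]

lemma hasSum_thetaImag {t : ℝ} (ht : 0 < t) (y : ℝ) :
    HasSum (fun n : ℤ => rexp (-π * t * n ^ 2 - 2 * π * n * y)) (thetaImag t y) := by
  have h := hasSum_jacobiTheta₂_term (I * y) (im_I_mul_ofReal_pos ht)
  simp_rw [jacobiTheta₂_term_imag] at h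
  simpa only [Complex.ofReal_re] using! Complex.hasSum_re h

lemma hasSum_thetaAlt {t : ℝ} (ht : 0 < t) (y : ℝ) :
    HasSum (fun n : ℤ => (-1) ^ n * rexp (-π * t * n ^ 2 - 2 * π * n * y)) (thetaAlt t y) := by
  have h := hasSum_jacobiTheta₂_term (I * y + 1 / 2) (im_I_mul_ofReal_pos ht)
  have e : ∀ n : ℤ, jacobiTheta₂_term n (I * y + 1 / 2) (I * t) =
      (((-1) ^ n * rexp (-π * t * n ^ 2 - 2 * π * n * y) : ℝ) : ℂ) := fun n => by
    rw [jacobiTheta₂_term_add_half, jacobiTheta₂_term_imag]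
    push_cast
    ring
  simp_rw [e] at h
  exact Complex.hasSum_re h

lemma ofReal_thetaImag {t : ℝ} (ht : 0 < t) (y : ℝ) :
    jacobiTheta₂ (I * y) (I * t) = thetaImag t y := by
  have h := hasSum_jacobiTheta₂_term (I * y) (im_I_mul_ofReal_pos ht)
  simp_rw [jacobiTheta₂_term_imag] at h
  exact h.unique (Complex.hasSum_ofReal.2 (hasSum_thetaImag ht y))

lemma ofReal_thetaAlt {t : ℝ} (ht : 0 < t) (y : ℝ) :
    jacobiTheta₂ (I * y + 1 / 2) (I * t) = thetaAlt t y := by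
  have h := hasSum_jacobiTheta₂_term (I * y + 1 / 2) (im_I_mul_ofReal_pos ht)
  refine h.unique ((congrArg (HasSum · _) (funext fun n => ?_)).mpr
    (Complex.hasSum_ofReal.2 (hasSum_thetaAlt ht y)))
  rw [jacobiTheta₂_term_add_half, jacobiTheta₂_term_imag]
  push_cast
  ring

lemma ofReal_thetaReal (t x : ℝ) : jacobiTheta₂ x (I * t) = thetaReal t x := by
  rw [thetaReal, ← cosKernel_def, Complex.ofReal_re]

lemma thetaImag_pos {t : ℝ} (ht : 0 < t) (y : ℝ) : 0 < thetaImag t y :=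
  (hasSum_thetaImag ht y).tsum_eq ▸
    (hasSum_thetaImag ht y).summable.tsum_pos (fun _ => (Real.exp_pos _).le) 0 (Real.exp_pos _)

lemma thetaAlt_le_thetaImag {t : ℝ} (ht : 0 < t) (y : ℝ) : thetaAlt t y ≤ thetaImag t y := by
  refine hasSum_le (fun n => ?_) (hasSum_thetaAlt ht y) (hasSum_thetaImag ht y)
  refine mul_le_of_le_one_left (Real.exp_pos _).le ?_
  rcases Int.even_or_odd n with h | h
  · rw [h.neg_one_zpow]
  · rw [h.neg_one_zpow]; norm_num

lemma thetaImag_neg {t : ℝ} (y : ℝ) : thetaImag t (-y) = thetaImag t y := by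
  rw [thetaImag, thetaImag, Complex.ofReal_neg, mul_neg, jacobiTheta₂_neg_left]

lemma thetaAlt_neg {t : ℝ} (y : ℝ) : thetaAlt t (-y) = thetaAlt t y := by
  rw [thetaAlt, thetaAlt, Complex.ofReal_neg, mul_neg, ← jacobiTheta₂_neg_left,
    ← jacobiTheta₂_add_left]
  ring_nf

lemma thetaReal_neg {t : ℝ} (x : ℝ) : thetaReal t (-x) = thetaReal t x := by
  rw [thetaReal, thetaReal, Complex.ofReal_neg, jacobiTheta₂_neg_left]

lemma thetaReal_add_one {t : ℝ} (x : ℝ) : thetaReal t (x + 1) = thetaReal t x := by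
  rw [thetaReal, thetaReal, Complex.ofReal_add, Complex.ofReal_one, jacobiTheta₂_add_left]

lemma thetaAlt_half (t : ℝ) : thetaAlt t (t / 2) = 0 := by
  have h := jacobiTheta₂_add_left' (-(I * t / 2) + 1 / 2) (I * t)
  rw [show -π * I * (I * t + 2 * (-(I * t / 2) + 1 / 2)) = -(π * I) by ring, Complex.exp_neg,
    exp_pi_mul_I, ← jacobiTheta₂_neg_left (-(I * t / 2) + 1 / 2), ← jacobiTheta₂_add_left (-_),
    show -(-(I * t / 2) + 1 / 2) + 1 = I * (t / 2) + 1 / 2 by ring,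
    show -(I * t / 2) + 1 / 2 + I * t = I * (t / 2) + 1 / 2 by ring] at h
  have h0 : jacobiTheta₂ (I * (t / 2) + 1 / 2) (I * t) = 0 := by
    norm_num at h
    exact self_eq_neg.1 h
  rw [thetaAlt]
  push_cast
  rw [h0, Complex.zero_re]

lemma thetaImag_mul_thetaAlt {t : ℝ} (ht : 0 < t) (y : ℝ) :
    thetaImag t y * thetaAlt t y = thetaAlt (2 * t) (2 * y) * thetaAlt (2 * t) 0 := by
  have h := jacobiTheta₂_mul_add_half (im_I_mul_ofReal_pos ht) (I * y)
  have h2 : 0 < 2 * t := by positivity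
  have e1 := ofReal_thetaAlt h2 (2 * y)
  have e2 := ofReal_thetaAlt h2 0
  push_cast at e1 e2
  rw [mul_zero, zero_add] at e2
  rw [ofReal_thetaImag ht, ofReal_thetaAlt ht, show 2 * (I * (y : ℂ)) = I * (2 * y) by ring,
    show 2 * (I * (t : ℂ)) = I * (2 * t) by ring, e1, e2] at h
  exact_mod_cast h

/-- For small nome the alternating theta series is positive before its first zero. -/
lemma thetaAlt_pos_of_one_le {t y : ℝ} (ht : 1 ≤ t) (hy : 0 ≤ y) (hyt : y < t / 2) :
    0 < thetaAlt t y := by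
  have ht0 : 0 < t := by linarith
  have h := (hasSum_thetaAlt ht0 y).nat_add_neg_add_one
  set x := rexp (2 * π * y - π * t) with hx
  have hx0 : 0 < x := Real.exp_pos _
  have hx1 : x < 1 := Real.exp_lt_one_iff.2 (by nlinarith [Real.pi_pos])
  set a : ℕ → ℝ := fun n => rexp (-π * t * n ^ 2 - 2 * π * n * y) * (1 - x ^ (2 * n + 1)) with ha
  have e : ∀ n : ℕ, (-1 : ℝ) ^ (n : ℤ) * rexp (-π * t * (n : ℤ) ^ 2 - 2 * π * (n : ℤ) * y) +
      (-1) ^ (-((n : ℤ) + 1)) * rexp (-π * t * (-((n : ℤ) + 1) : ℤ) ^ 2 -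
        2 * π * (-((n : ℤ) + 1) : ℤ) * y) = (-1) ^ n * a n := fun n => by
    have e1 : rexp (-π * t * (-((n : ℤ) + 1) : ℤ) ^ 2 - 2 * π * (-((n : ℤ) + 1) : ℤ) * y) =
        rexp (-π * t * n ^ 2 - 2 * π * n * y) * x ^ (2 * n + 1) := by
      rw [hx, ← Real.exp_nat_mul, ← Real.exp_add]
      push_cast
      ring_nf
    have e2 : (-1 : ℝ) ^ (-((n : ℤ) + 1)) = -(-1) ^ n := by
      rw [zpow_neg, zpow_add₀ (by norm_num), zpow_natCast]
      rcases neg_one_pow_eq_or ℝ n with h | h <;> rw [h] <;> norm_num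
    rw [e1, e2, zpow_natCast, ha]
    push_cast
    ring
  simp_rw [e] at h
  have hstep : ∀ n, a (n + 1) < a n := fun n => by
    have hw0 : 0 < x ^ (2 * n + 1) := by positivity
    have hwx : x ^ (2 * n + 1) ≤ x := pow_le_of_le_one hx0.le hx1.le (by omega)
    set w := x ^ (2 * n + 1) with hw
    have hE : rexp (-π * t * (n + 1 : ℕ) ^ 2 - 2 * π * (n + 1 : ℕ) * y) ≤
        rexp (-π * t * n ^ 2 - 2 * π * n * y) * (1 / 4) := by
      have h4 : rexp (-2) ≤ 1 / 4 := by
        rw [Real.exp_neg, inv_eq_one_div]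
        refine one_div_le_one_div_of_le (by norm_num) ?_
        have h1 := Real.add_one_le_exp (1 : ℝ)
        calc (4 : ℝ) ≤ rexp 1 * rexp 1 := by nlinarith
          _ = rexp 2 := by rw [← Real.exp_add]; norm_num
      refine le_trans ?_ (mul_le_mul_of_nonneg_left h4 (Real.exp_pos _).le)
      rw [← Real.exp_add, Real.exp_le_exp]
      push_cast
      have h3 : 2 ≤ π * t := by nlinarith [Real.pi_gt_three]
      have h5 : 0 ≤ π * t * n := by positivity
      have h6 : 0 ≤ π * y := by positivity
      nlinarith
    have hlt : 1 - x ^ (2 * (n + 1) + 1) ≤ 3 * (1 - w) := by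
      have : x ^ (2 * (n + 1) + 1) = w * x ^ 2 := by rw [hw]; ring
      rw [this]
      have h1 : w * w ^ 2 ≤ w * x ^ 2 := by gcongr
      nlinarith [mul_nonneg (sq_nonneg (1 - w)) (by linarith : 0 ≤ w + 2)]
    have hpos : 0 ≤ 1 - x ^ (2 * (n + 1) + 1) := by
      linarith [pow_le_one₀ hx0.le hx1.le (n := 2 * (n + 1) + 1)]
    have hE0 := Real.exp_pos (-π * t * n ^ 2 - 2 * π * n * y)
    calc a (n + 1) ≤ rexp (-π * t * n ^ 2 - 2 * π * n * y) * (1 / 4) * (3 * (1 - w)) := by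
          simp only [ha]
          exact mul_le_mul hE hlt hpos (by positivity)
      _ < rexp (-π * t * n ^ 2 - 2 * π * n * y) * (1 - w) := by
          have : 0 < rexp (-π * t * n ^ 2 - 2 * π * n * y) * (1 - w) :=
            mul_pos hE0 (by linarith)
          linarith
  have hanti : Antitone a := antitone_nat_of_succ_le fun n => (hstep n).le
  have hle := hanti.alternating_series_le_tendsto h.tendsto_sum_nat 1
  simp only [Finset.sum_range_succ, Finset.sum_range_zero, mul_one] at hle
  have := hstep 0
  norm_num at hle this
  linarith

/-- The alternating theta series is positive before its first zero. -/
lemma thetaAlt_pos {t y : ℝ} (ht : 0 < t) (hy : 0 ≤ y) (hyt : y < t / 2) : 0 < thetaAlt t y := by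
  obtain ⟨n, hn⟩ : ∃ n : ℕ, 1 / t < 2 ^ n := pow_unbounded_of_one_lt _ one_lt_two
  have hn' : 1 ≤ 2 ^ n * t := by
    rw [div_lt_iff₀ ht] at hn
    exact hn.le
  clear hn
  induction n generalizing t y with
  | zero => exact thetaAlt_pos_of_one_le (by simpa using hn') hy hyt
  | succ n ih =>
    have h2 : 1 ≤ 2 ^ n * (2 * t) := by rw [pow_succ] at hn'; linarith
    have h := thetaImag_mul_thetaAlt ht y
    have h3 : 0 < thetaImag t y * thetaAlt t y := by
      rw [h]
      exact mul_pos (ih (by linarith) (by linarith) (by linarith) h2)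
        (ih (by linarith) le_rfl (by linarith) h2)
    exact (pos_iff_pos_of_mul_pos h3).1 (thetaImag_pos ht y)

lemma jacobiTheta₂_add_add_half {τ : ℂ} (hτ : 0 < τ.im) (z : ℂ) :
    jacobiTheta₂ z τ + jacobiTheta₂ (z + 1 / 2) τ = 2 * jacobiTheta₂ (2 * z) (4 * τ) := by
  have h := (hasSum_jacobiTheta₂_term z hτ).add (hasSum_jacobiTheta₂_term (z + 1 / 2) hτ)
  have hinj : Function.Injective fun n : ℤ => 2 * n := fun a b h => by simpa using h
  rw [← hinj.hasSum_iff] at h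
  · have h4 : 0 < (4 * τ).im := by simpa using hτ
    refine h.unique ((congrArg (HasSum · _) (funext fun n => ?_)).mpr
      ((hasSum_jacobiTheta₂_term (2 * z) h4).mul_left 2))
    have : jacobiTheta₂_term (2 * n) z τ = jacobiTheta₂_term n (2 * z) (4 * τ) := by
      rw [jacobiTheta₂_term, jacobiTheta₂_term]
      push_cast
      ring_nf
    simp only [Function.comp_apply, jacobiTheta₂_term_add_half, zpow_mul, this]
    norm_num
    ring
  · intro n hn
    have hodd : Odd n := by
      rw [← Int.not_even_iff_odd]
      rintro ⟨m, rfl⟩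
      exact hn ⟨m, by simp only; ring⟩
    rw [jacobiTheta₂_term_add_half, hodd.neg_one_zpow]
    ring

lemma thetaImag_add_thetaAlt {t : ℝ} (ht : 0 < t) (y : ℝ) :
    thetaImag t y + thetaAlt t y = 2 * thetaImag (4 * t) (2 * y) := by
  have h := congrArg Complex.re (jacobiTheta₂_add_add_half (im_I_mul_ofReal_pos ht) (I * y))
  rw [show 2 * (I * (y : ℂ)) = I * (2 * y : ℝ) by push_cast; ring,
    show 4 * (I * (t : ℂ)) = I * (4 * t : ℝ) by push_cast; ring] at h
  simpa [thetaImag, thetaAlt] using h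

lemma thetaReal_add_thetaReal {t : ℝ} (ht : 0 < t) (x : ℝ) :
    thetaReal t x + thetaReal t (x + 1 / 2) = 2 * thetaReal (4 * t) (2 * x) := by
  have h := congrArg Complex.re (jacobiTheta₂_add_add_half (im_I_mul_ofReal_pos ht) x)
  rw [show 2 * (x : ℂ) = (2 * x : ℝ) by push_cast; ring,
    show 4 * (I * (t : ℂ)) = I * (4 * t : ℝ) by push_cast; ring] at h
  simpa [thetaReal] using h

/-- The imaginary transformation of the theta function, in real form. -/
lemma thetaReal_eq_thetaImag {t : ℝ} (ht : 0 < t) (x : ℝ) :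
    thetaReal t x = (√t)⁻¹ * rexp (-π * x ^ 2 / t) * thetaImag (1 / t) (x / t) := by
  have h := evenKernel_functional_equation x (1 / t)
  have h1 := evenKernel_def x (1 / t)
  have e1 : (x : ℂ) * I * (1 / t : ℝ) = I * (x / t : ℝ) := by push_cast; ring
  rw [e1, ofReal_thetaImag (by positivity)] at h1
  have h2 : evenKernel x (1 / t) = rexp (-π * x ^ 2 * (1 / t)) * thetaImag (1 / t) (x / t) := by
    exact_mod_cast h1
  have h3 : cosKernel x t = thetaReal t x := by
    rw [thetaReal, ← cosKernel_def, Complex.ofReal_re]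
  rw [h2, one_div_one_div, h3, ← Real.sqrt_eq_rpow, one_div, Real.sqrt_inv] at h
  have hs : 0 < √t := Real.sqrt_pos.2 ht
  rw [mul_assoc, div_eq_mul_inv _ t, one_div, h]
  field_simp

lemma thetaReal_pos {t : ℝ} (ht : 0 < t) (x : ℝ) : 0 < thetaReal t x := by
  rw [thetaReal_eq_thetaImag ht]
  have := thetaImag_pos (t := 1 / t) (by positivity) (x / t)
  have := Real.sqrt_pos.2 ht
  positivity

lemma thetaReal_add_half_lt {t x : ℝ} (ht : 0 < t) (hx : 0 ≤ x) (hx4 : x < 1 / 4) :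
    thetaReal t (x + 1 / 2) < thetaReal t x := by
  have h1 := thetaReal_add_thetaReal ht x
  have h2 := thetaReal_eq_thetaImag ht x
  have h3 := thetaReal_eq_thetaImag (t := 4 * t) (by positivity) (2 * x)
  have hs : 0 < √t := Real.sqrt_pos.2 ht
  rw [show √(4 * t) = 2 * √t by
      rw [Real.sqrt_mul (by norm_num), show (4 : ℝ) = 2 ^ 2 by norm_num, Real.sqrt_sq two_pos.le],
    show -π * (2 * x) ^ 2 / (4 * t) = -π * x ^ 2 / t by field_simp; ring,
    show 2 * x / (4 * t) = x / (2 * t) by field_simp; ring] at h3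
  have h4 := thetaImag_add_thetaAlt (t := 1 / (4 * t)) (by positivity) (x / (2 * t))
  rw [show 4 * (1 / (4 * t)) = 1 / t by field_simp,
    show 2 * (x / (2 * t)) = x / t by field_simp] at h4
  have h5 : 0 < thetaAlt (1 / (4 * t)) (x / (2 * t)) := by
    refine thetaAlt_pos (by positivity) (by positivity) ?_
    rw [div_div, div_lt_div_iff₀ (by positivity) (by positivity)]
    nlinarith
  have h6 : thetaReal t x - thetaReal t (x + 1 / 2) =
      (√t)⁻¹ * rexp (-π * x ^ 2 / t) * thetaAlt (1 / (4 * t)) (x / (2 * t)) := by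
    have : thetaReal t x - thetaReal t (x + 1 / 2) =
      2 * thetaReal t x - 2 * thetaReal (4 * t) (2 * x) := by linarith
    rw [this, h2, h3, mul_inv]
    linear_combination (-(√t)⁻¹ * rexp (-π * x ^ 2 / t)) * h4
  have : 0 < thetaReal t x - thetaReal t (x + 1 / 2) := by
    rw [h6]
    positivity
  linarith

/-- The differential equation satisfied by each of a pair of companion theta functions. -/
structure ThetaODE (b c : ℝ) (f g : ℝ → ℝ) : Prop where
  differentiable : Differentiable ℝ f
  differentiable_deriv : Differentiable ℝ (deriv f)
  eq : ∀ x, deriv (deriv f) x * f x - deriv f x ^ 2 = b * g x ^ 2 - c * f x ^ 2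

lemma differentiable_of_ofReal_eq {f : ℂ → ℂ} (hf : Differentiable ℂ f) {w a : ℂ} {g : ℝ → ℝ}
    (hg : ∀ x : ℝ, f (w + a * x) = g x) :
    Differentiable ℝ g ∧ ∀ x : ℝ, a * deriv f (w + a * x) = ((deriv g x : ℝ) : ℂ) := by
  have key : ∀ x : ℝ, HasDerivAt g (a * deriv f (w + a * x)).re x ∧
      a * deriv f (w + a * x) = ((a * deriv f (w + a * x)).re : ℂ) := fun x => by
    have h1 : HasDerivAt (fun z : ℂ => f (w + a * z)) (a * deriv f (w + a * x)) x := by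
      have h2 : HasDerivAt (fun z : ℂ => w + a * z) a (x : ℂ) := by
        simpa using ((hasDerivAt_id (x : ℂ)).const_mul a).const_add w
      have h3 := (hf (w + a * x)).hasDerivAt.comp (x : ℂ) h2
      rw [mul_comm] at h3
      exact h3
    have h4 : HasDerivAt g (a * deriv f (w + a * x)).re x := by
      have := h1.real_of_complex
      simp only [hg, Complex.ofReal_re] at this
      exact this
    have h5 := h1.comp_ofReal
    simp only [hg] at h5
    exact ⟨h4, h5.unique h4.ofReal_comp⟩
  refine ⟨fun x => (key x).1.differentiableAt, fun x => ?_⟩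
  rw [(key x).1.deriv]
  exact (key x).2

lemma ThetaODE.of_complex {f : ℂ → ℂ} (hf : Differentiable ℂ f) {b c w a : ℂ} {g h : ℝ → ℝ}
    {σ : ℝ} (ha : a ^ 2 = σ) (hg : ∀ x : ℝ, f (w + a * x) = g x)
    (hh : ∀ x : ℝ, f (w + a * x + 1 / 2) = h x)
    (hode : ∀ z, deriv (deriv f) z * f z - deriv f z ^ 2 = b * f (z + 1 / 2) ^ 2 - c * f z ^ 2) :
    ThetaODE (σ * b.re) (σ * c.re) g h := by
  obtain ⟨h1, h2⟩ := differentiable_of_ofReal_eq hf hg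
  have hf' : Differentiable ℂ fun z => a * deriv f z :=
    (differentiable_deriv_of_complex hf).const_mul a
  obtain ⟨h3, h4⟩ := differentiable_of_ofReal_eq hf' h2
  refine ⟨h1, h3, fun x => ?_⟩
  have h5 := hode (w + a * x)
  have h6 := h4 x
  rw [deriv_const_mul a (differentiable_deriv_of_complex hf _)] at h6
  have h7 : ((deriv (deriv g) x * g x - deriv g x ^ 2 : ℝ) : ℂ) =
      ((σ * h x ^ 2 : ℝ) : ℂ) * b - ((σ * g x ^ 2 : ℝ) : ℂ) * c := by
    push_cast
    rw [← h6, ← h2 x, ← hg x, ← hh x, ← ha]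
    linear_combination a ^ 2 * h5
  have h8 := congrArg Complex.re h7
  rw [Complex.ofReal_re, Complex.sub_re, Complex.re_ofReal_mul, Complex.re_ofReal_mul] at h8
  rw [h8]
  ring

/-- The theta functions with purely imaginary parameter satisfy a common pair of equations
along the real and along the imaginary axis. -/
lemma exists_thetaODE {t : ℝ} (ht : 0 < t) : ∃ b c : ℝ,
    ThetaODE b c (thetaReal t) (fun x => thetaReal t (x + 1 / 2)) ∧
    ThetaODE b c (fun x => thetaReal t (x + 1 / 2)) (thetaReal t) ∧
    ThetaODE (-b) (-c) (thetaImag t) (thetaAlt t) ∧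
    ThetaODE (-b) (-c) (thetaAlt t) (thetaImag t) := by
  have hτ := im_I_mul_ofReal_pos ht
  have h2 : 0 < 2 * t := by positivity
  have hE : thetaEven (I * t) 0 ≠ 0 := by
    have h := ofReal_thetaImag h2 0
    rw [thetaEven, mul_zero, show 2 * (I * (t : ℂ)) = I * (2 * t : ℝ) by push_cast; ring]
    rw [Complex.ofReal_zero, mul_zero] at h
    rw [h]
    exact_mod_cast (thetaImag_pos h2 0).ne'
  have hO : thetaOdd (I * t) 0 ≠ 0 := by
    rw [thetaOdd, mul_zero (2 : ℂ), zero_add,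
      show 2 * (I * (t : ℂ)) = I * (2 * t : ℝ) by push_cast; ring,
      ofReal_thetaImag h2]
    exact mul_ne_zero (Complex.exp_ne_zero _) (by exact_mod_cast (thetaImag_pos h2 t).ne')
  obtain ⟨b, c, hode⟩ := exists_theta_wronskian hτ hE hO
  have hd := differentiable_jacobiTheta₂ hτ
  have hre : ∀ x : ℝ, jacobiTheta₂ (x + 1 / 2) (I * t) = thetaReal t (x + 1 / 2) := fun x => by
    rw [← ofReal_thetaReal]
    push_cast
    rfl
  have hp : ∀ z : ℂ, jacobiTheta₂ (z + 1 / 2 + 1 / 2) (I * t) = jacobiTheta₂ z (I * t) :=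
    fun z => by rw [add_assoc, add_halves, jacobiTheta₂_add_left]
  refine ⟨b.re, c.re, ?_, ?_, ?_, ?_⟩
  · have := ThetaODE.of_complex hd (w := 0) (a := 1) (σ := 1) (by simp)
      (fun x => by rw [zero_add, one_mul, ofReal_thetaReal])
      (fun x => by rw [zero_add, one_mul, hre]) hode
    rwa [one_mul, one_mul] at this
  · have := ThetaODE.of_complex hd (w := 1 / 2) (a := 1) (σ := 1) (by simp)
      (fun x => by rw [add_comm, one_mul, hre])
      (fun x => by rw [add_comm (1 / 2 : ℂ), one_mul, hp, ofReal_thetaReal]) hode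
    rwa [one_mul, one_mul] at this
  · have := ThetaODE.of_complex hd (w := 0) (a := I) (σ := -1) (by simp)
      (fun x => by rw [zero_add, ofReal_thetaImag ht])
      (fun x => by rw [zero_add, ofReal_thetaAlt ht]) hode
    rwa [neg_one_mul, neg_one_mul] at this
  · have := ThetaODE.of_complex hd (w := 1 / 2) (a := I) (σ := -1) (by simp)
      (fun x => by rw [add_comm, ofReal_thetaAlt ht])
      (fun x => by rw [add_comm (1 / 2 : ℂ), hp, ofReal_thetaImag ht]) hode
    rwa [neg_one_mul, neg_one_mul] at this

/-- The first integral of a pair of companion theta equations. -/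
lemma ThetaODE.energy {b c T : ℝ} {f g : ℝ → ℝ} (hf : ThetaODE b c f g) (hg : ThetaODE b c g f)
    (hf0 : deriv f 0 = 0) (hg0 : deriv g 0 = 0) (hfpos : ∀ x, 0 ≤ x → x < T → 0 < f x)
    (hgpos : ∀ x, 0 ≤ x → x < T → 0 < g x) {x : ℝ} (hx : 0 ≤ x) (hxT : x < T) :
    g 0 ^ 2 * f 0 ^ 2 * (deriv f x * g x - deriv g x * f x) ^ 2 =
      b * (f 0 ^ 2 * g x ^ 2 - g 0 ^ 2 * f x ^ 2) * (f 0 ^ 2 * f x ^ 2 - g 0 ^ 2 * g x ^ 2) := by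
  set J : ℝ → ℝ := fun x => ((deriv f x * g x - deriv g x * f x) ^ 2 + b * (f x ^ 4 + g x ^ 4)) /
    (f x ^ 2 * g x ^ 2) with hJ
  have hderiv : ∀ y, 0 ≤ y → y < T → HasDerivAt J 0 y := fun y hy hyT => by
    have hfy := hfpos y hy hyT
    have hgy := hgpos y hy hyT
    have f1 := (hf.differentiable y).hasDerivAt
    have g1 := (hg.differentiable y).hasDerivAt
    have f2 := (hf.differentiable_deriv y).hasDerivAt
    have g2 := (hg.differentiable_deriv y).hasDerivAt
    have ef : deriv (deriv f) y = (deriv f y ^ 2 + b * g y ^ 2 - c * f y ^ 2) / f y := by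
      rw [eq_div_iff hfy.ne']
      linarith [hf.eq y]
    have eg : deriv (deriv g) y = (deriv g y ^ 2 + b * f y ^ 2 - c * g y ^ 2) / g y := by
      rw [eq_div_iff hgy.ne']
      linarith [hg.eq y]
    rw [ef] at f2
    rw [eg] at g2
    have hd := ((((f2.mul g1).sub (g2.mul f1)).pow 2).add
      (((f1.pow 4).add (g1.pow 4)).const_mul b)).div ((f1.pow 2).mul (g1.pow 2))
      (by simp only [Pi.mul_apply, Pi.pow_apply]; positivity)
    refine hd.congr_deriv ?_
    simp only [Pi.mul_apply, Pi.pow_apply, Pi.sub_apply, Pi.add_apply]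
    field_simp
    ring
  have hconst : J x = J 0 := by
    refine constant_of_has_deriv_right_zero (f := J) (a := 0) (b := x)
      (fun y hy => (hderiv y hy.1 (hy.2.trans_lt hxT)).continuousAt.continuousWithinAt)
      (fun y hy => (hderiv y hy.1 (hy.2.trans hxT)).hasDerivWithinAt) x ⟨hx, le_rfl⟩
  have hfx := hfpos x hx hxT
  have hgx := hgpos x hx hxT
  have hf00 := hfpos 0 le_rfl (hx.trans_lt hxT)
  have hg00 := hgpos 0 le_rfl (hx.trans_lt hxT)
  simp only [hJ, hf0, hg0] at hconst
  rw [div_eq_div_iff (by positivity) (by positivity)] at hconst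
  linear_combination hconst

/-- The amplitude whose squared sine is `X`, and its derivative. -/
lemma hasDerivAt_half_arccos {X : ℝ → ℝ} {X' x : ℝ} (h0 : 0 < X x) (h1 : X x < 1)
    (hX : HasDerivAt X X' x) : HasDerivAt (fun x => Real.arccos (1 - 2 * X x) / 2)
      (X' / (2 * √(X x * (1 - X x)))) x := by
  have hd := ((hX.const_mul 2).const_sub 1)
  have ha := (Real.hasDerivAt_arccos (x := 1 - 2 * X x) (by linarith) (by linarith)).comp x hd
  refine (ha.div_const 2).congr_deriv ?_
  rw [show 1 - (1 - 2 * X x) ^ 2 = 2 ^ 2 * (X x * (1 - X x)) by ring,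
    Real.sqrt_mul (by norm_num), Real.sqrt_sq two_pos.le]
  ring

/-- The Legendre form of the complete elliptic integral, evaluated along a solution of the
corresponding differential equation. -/
lemma integral_eq_of_deriv_sq {m l T : ℝ} {X X' : ℝ → ℝ} (hm : m < 1) (hm0 : 0 ≤ m) (hl : 0 ≤ l)
    (hT : 0 < T) (hcont : ContinuousOn X (Set.Icc 0 T)) (hX0 : X 0 = 0) (hXT : X T = 1)
    (hpos : ∀ x ∈ Set.Ioo 0 T, 0 < X x) (hlt : ∀ x ∈ Set.Ioo 0 T, X x < 1)
    (hX : ∀ x ∈ Set.Ioo 0 T, HasDerivAt X (X' x) x) (hX' : ∀ x ∈ Set.Ioo 0 T, 0 ≤ X' x)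
    (hsq : ∀ x ∈ Set.Ioo 0 T, X' x ^ 2 = 4 * l ^ 2 * (X x * (1 - X x) * (1 - m * X x))) :
    ∫ θ in (0 : ℝ)..(π / 2), 1 / √(1 - m * Real.sin θ ^ 2) = l * T := by
  have hp : ∀ θ : ℝ, 0 < 1 - m * Real.sin θ ^ 2 := fun θ => by
    nlinarith [Real.sin_sq_le_one θ, sq_nonneg (Real.sin θ)]
  have hc : Continuous fun θ : ℝ => 1 / √(1 - m * Real.sin θ ^ 2) :=
    continuous_const.div (by fun_prop) fun θ => (Real.sqrt_pos.2 (hp θ)).ne'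
  set M : ℝ → ℝ := fun φ => ∫ θ in (0 : ℝ)..φ, 1 / √(1 - m * Real.sin θ ^ 2) with hM
  have hMd : ∀ φ, HasDerivAt M (1 / √(1 - m * Real.sin φ ^ 2)) φ := fun φ =>
    intervalIntegral.integral_hasDerivAt_right (hc.intervalIntegrable _ _)
      (hc.stronglyMeasurableAtFilter _ _) hc.continuousAt
  have hMc : Continuous M := continuous_iff_continuousAt.2 fun φ => (hMd φ).continuousAt
  set Φ : ℝ → ℝ := fun x => Real.arccos (1 - 2 * X x) / 2 with hΦ
  have hΦc : ContinuousOn Φ (Set.Icc 0 T) :=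
    (Real.continuous_arccos.comp_continuousOn
      (continuousOn_const.sub (continuousOn_const.mul hcont))).div_const 2
  have hder : ∀ x ∈ Set.Ioo 0 T, HasDerivAt (fun x => M (Φ x)) l x := fun x hx => by
    have h0 := hpos x hx
    have h1 := hlt x hx
    have hφ := hasDerivAt_half_arccos h0 h1 (hX x hx)
    have hs : Real.sin (Φ x) ^ 2 = X x := by
      rw [Real.sin_sq_eq_half_sub, hΦ]
      simp only
      rw [mul_div_cancel₀ _ (two_ne_zero), Real.cos_arccos (by linarith) (by linarith)]
      ring
    refine ((hMd (Φ x)).comp x hφ).congr_deriv ?_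
    have h2 : 0 < 1 - m * X x := hs ▸ hp (Φ x)
    have h3 : 0 < X x * (1 - X x) := mul_pos h0 (by linarith)
    have h4 : X' x = 2 * l * (√(X x * (1 - X x)) * √(1 - m * X x)) := by
      rw [← Real.sqrt_mul h3.le, ← sq_eq_sq₀ (hX' x hx) (by positivity), hsq x hx, mul_pow,
        Real.sq_sqrt (by positivity)]
      ring
    have h5 := Real.sqrt_pos.2 h3
    have h6 := Real.sqrt_pos.2 h2
    rw [hs, h4]
    field_simp
  obtain ⟨x, -, hx⟩ := exists_hasDerivAt_eq_slope (fun x => M (Φ x)) (fun _ => l) hT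
    (hMc.comp_continuousOn hΦc) hder
  have e0 : M (Φ 0) = 0 := by simp [hM, hΦ, hX0]
  have e1 : Φ T = π / 2 := by
    simp only [hΦ, hXT]
    norm_num
  simp only [e0, e1, sub_zero] at hx
  rw [eq_div_iff hT.ne'] at hx
  exact hx.symm

lemma ThetaODE.hasDerivAt_logDeriv {b c x : ℝ} {f g : ℝ → ℝ} (h : ThetaODE b c f g)
    (hx : f x ≠ 0) :
    HasDerivAt (fun x => deriv f x / f x) (b * (g x / f x) ^ 2 - c) x := by
  refine ((h.differentiable_deriv x).hasDerivAt.div (h.differentiable x).hasDerivAt hx).congr_deriv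
    ?_
  have := h.eq x
  field_simp
  linear_combination this

lemma ThetaODE.hasDerivAt_sub_logDeriv {b c x : ℝ} {f g : ℝ → ℝ} (hf : ThetaODE b c f g)
    (hg : ThetaODE b c g f) (hfx : f x ≠ 0) (hgx : g x ≠ 0) :
    HasDerivAt (fun x => deriv f x / f x - deriv g x / g x)
      (b * ((g x / f x) ^ 2 - (f x / g x) ^ 2)) x :=
  ((hf.hasDerivAt_logDeriv hfx).sub (hg.hasDerivAt_logDeriv hgx)).congr_deriv (by ring)

lemma ThetaODE.hasDerivAt_div {b c x : ℝ} {f g : ℝ → ℝ} (hf : ThetaODE b c f g)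
    (hg : ThetaODE b c g f) (hfx : f x ≠ 0) (hgx : g x ≠ 0) :
    HasDerivAt (fun x => f x / g x) (f x / g x * (deriv f x / f x - deriv g x / g x)) x := by
  refine ((hf.differentiable x).hasDerivAt.div (hg.differentiable x).hasDerivAt hgx).congr_deriv ?_
  field_simp

lemma deriv_zero_of_even {f : ℝ → ℝ} (hf : ∀ x, f (-x) = f x) : deriv f 0 = 0 := by
  have h := deriv_comp_neg f (0 : ℝ)
  simp only [hf, neg_zero] at h
  linarith

/-- A pair of companion theta functions along the real axis, normalised to period one. -/
structure ThetaPair (b c : ℝ) (f g : ℝ → ℝ) : Prop where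
  fst : ThetaODE b c f g
  snd : ThetaODE b c g f
  fst_pos : ∀ x, 0 < f x
  snd_pos : ∀ x, 0 < g x
  fst_even : ∀ x, f (-x) = f x
  snd_even : ∀ x, g (-x) = g x
  reflect : ∀ x, f (1 / 2 - x) = g x
  lt : ∀ x, 0 ≤ x → x < 1 / 4 → g x < f x

namespace ThetaPair

variable {b c : ℝ} {f g : ℝ → ℝ}

lemma reflect_snd (h : ThetaPair b c f g) (x : ℝ) : g (1 / 2 - x) = f x := by
  rw [← h.reflect, sub_sub_cancel]

lemma deriv_fst_reflect (h : ThetaPair b c f g) (x : ℝ) :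
    deriv f (1 / 2 - x) = -deriv g x := by
  have := deriv_comp_const_sub (f := f) (1 / 2) x
  simp only [h.reflect] at this
  rw [this, neg_neg]

lemma deriv_snd_reflect (h : ThetaPair b c f g) (x : ℝ) :
    deriv g (1 / 2 - x) = -deriv f x := by
  have := deriv_comp_const_sub (f := g) (1 / 2) x
  simp only [h.reflect_snd] at this
  rw [this, neg_neg]

lemma eq_quarter (h : ThetaPair b c f g) : g (1 / 4) = f (1 / 4) := by
  rw [← h.reflect]
  norm_num

lemma b_pos (h : ThetaPair b c f g) : 0 < b := by
  have hf0 := h.fst_pos 0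
  have hg0 := h.snd_pos 0
  have hlt := h.lt 0 le_rfl (by norm_num)
  have hen := h.fst.energy h.snd (deriv_zero_of_even h.fst_even) (deriv_zero_of_even h.snd_even)
    (T := 1) (fun x _ _ => h.fst_pos x) (fun x _ _ => h.snd_pos x) (x := 1 / 4) (by norm_num)
    (by norm_num)
  rw [h.eq_quarter] at hen
  have hpos : 0 < (f 0 ^ 2 - g 0 ^ 2) ^ 2 * f (1 / 4) ^ 4 := by
    have := h.fst_pos (1 / 4)
    have : 0 < f 0 ^ 2 - g 0 ^ 2 := by nlinarith
    positivity
  have hb : 0 ≤ b := by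
    refine nonneg_of_mul_nonneg_left (b := (f 0 ^ 2 - g 0 ^ 2) ^ 2 * f (1 / 4) ^ 4) ?_ hpos
    rw [show b * ((f 0 ^ 2 - g 0 ^ 2) ^ 2 * f (1 / 4) ^ 4) = b *
      (f 0 ^ 2 * f (1 / 4) ^ 2 - g 0 ^ 2 * f (1 / 4) ^ 2) *
        (f 0 ^ 2 * f (1 / 4) ^ 2 - g 0 ^ 2 * f (1 / 4) ^ 2) by ring, ← hen]
    positivity
  refine hb.lt_of_ne' fun hb0 => ?_
  have hne := fun x => (h.fst_pos x).ne'
  have hne' := fun x => (h.snd_pos x).ne'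
  have hd := fun x => h.fst.hasDerivAt_sub_logDeriv h.snd (hne x) (hne' x)
  simp only [hb0, zero_mul] at hd
  have he : ∀ x, deriv f x / f x - deriv g x / g x = 0 := fun x => by
    have := is_const_of_deriv_eq_zero (fun x => (hd x).differentiableAt) (fun x => (hd x).deriv) x 0
    simpa [deriv_zero_of_even h.fst_even, deriv_zero_of_even h.snd_even] using this
  have hD := fun x => h.fst.hasDerivAt_div h.snd (hne x) (hne' x)
  simp only [he, mul_zero] at hD
  have := is_const_of_deriv_eq_zero (fun x => (hD x).differentiableAt) (fun x => (hD x).deriv)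
    0 (1 / 4)
  simp only [h.eq_quarter] at this
  rw [div_self (hne _), div_eq_one_iff_eq (hne' 0)] at this
  linarith

lemma sub_logDeriv_neg (h : ThetaPair b c f g) {x : ℝ} (hx : 0 < x) (hx2 : x < 1 / 2) :
    deriv f x / f x - deriv g x / g x < 0 := by
  have hd := fun x => h.fst.hasDerivAt_sub_logDeriv h.snd (h.fst_pos x).ne' (h.snd_pos x).ne'
  have hanti : StrictAntiOn (fun x => deriv f x / f x - deriv g x / g x) (Set.Icc 0 (1 / 4)) := by
    refine strictAntiOn_of_deriv_neg (convex_Icc _ _)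
      (fun x _ => (hd x).continuousAt.continuousWithinAt) fun x hx => ?_
    rw [interior_Icc] at hx
    rw [(hd x).deriv]
    have hlt := h.lt x hx.1.le hx.2
    have hfx := h.fst_pos x
    have hgx := h.snd_pos x
    refine mul_neg_of_pos_of_neg h.b_pos ?_
    have h1 : g x / f x < 1 := (div_lt_one hfx).2 hlt
    have h2 : 1 < f x / g x := (one_lt_div hgx).2 hlt
    have h3 : 0 < g x / f x := by positivity
    nlinarith
  have key : ∀ y, 0 < y → y ≤ 1 / 4 → deriv f y / f y - deriv g y / g y < 0 := fun y hy hy4 => by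
    have := hanti ⟨le_rfl, by norm_num⟩ ⟨hy.le, hy4⟩ hy
    simpa [deriv_zero_of_even h.fst_even, deriv_zero_of_even h.snd_even] using this
  rcases le_total x (1 / 4) with hx4 | hx4
  · exact key x hx hx4
  · have := key (1 / 2 - x) (by linarith) (by linarith)
    rw [h.deriv_fst_reflect, h.deriv_snd_reflect, h.reflect, h.reflect_snd, neg_div,
      neg_div] at this
    linarith

lemma strictAntiOn_div (h : ThetaPair b c f g) :
    StrictAntiOn (fun x => f x / g x) (Set.Icc 0 (1 / 2)) := by
  have hd := fun x => h.fst.hasDerivAt_div h.snd (h.fst_pos x).ne' (h.snd_pos x).ne'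
  refine strictAntiOn_of_deriv_neg (convex_Icc _ _)
    (fun x _ => (hd x).continuousAt.continuousWithinAt) fun x hx => ?_
  rw [interior_Icc] at hx
  rw [(hd x).deriv]
  exact mul_neg_of_pos_of_neg (div_pos (h.fst_pos x) (h.snd_pos x)) (h.sub_logDeriv_neg hx.1 hx.2)

lemma logDeriv_snd_zero (h : ThetaPair b c f g) : deriv g 0 / g 0 = 0 := by
  rw [deriv_zero_of_even h.snd_even, zero_div]

lemma logDeriv_snd_half (h : ThetaPair b c f g) : deriv g (1 / 2) / g (1 / 2) = 0 := by
  have := h.deriv_snd_reflect 0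
  rw [deriv_zero_of_even h.fst_even, neg_zero, sub_zero] at this
  rw [this, zero_div]

lemma logDeriv_snd_pos (h : ThetaPair b c f g) {x : ℝ} (hx : 0 < x) (hx2 : x < 1 / 2) :
    0 < deriv g x / g x := by
  have hd := fun x => h.snd.hasDerivAt_logDeriv (h.snd_pos x).ne'
  have hconc : StrictConcaveOn ℝ (Set.Icc 0 (1 / 2)) fun x => deriv g x / g x := by
    refine StrictAntiOn.strictConcaveOn_of_deriv (convex_Icc _ _)
      (fun x _ => (hd x).continuousAt.continuousWithinAt) fun x hx y hy hxy => ?_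
    rw [interior_Icc] at hx hy
    rw [(hd x).deriv, (hd y).deriv]
    have h1 := h.strictAntiOn_div (Set.Ioo_subset_Icc_self hx) (Set.Ioo_subset_Icc_self hy) hxy
    have h2 : 0 < f y / g y := div_pos (h.fst_pos y) (h.snd_pos y)
    have h3 : (f y / g y) ^ 2 < (f x / g x) ^ 2 := by gcongr
    have := mul_lt_mul_of_pos_left h3 h.b_pos
    linarith
  have h0 : (0 : ℝ) ∈ Set.Icc (0 : ℝ) (1 / 2) := ⟨le_rfl, by norm_num⟩
  have h1 : (1 / 2 : ℝ) ∈ Set.Icc (0 : ℝ) (1 / 2) := ⟨by norm_num, le_rfl⟩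
  have := hconc.2 h0 h1 (by norm_num) (by linarith : 0 < 1 - 2 * x) (by linarith : 0 < 2 * x)
    (by ring)
  simp only [h.logDeriv_snd_zero, h.logDeriv_snd_half, smul_eq_mul, mul_zero, zero_add] at this
  rwa [show 2 * x * (1 / 2) = x by ring] at this

lemma logDeriv_fst_neg (h : ThetaPair b c f g) {x : ℝ} (hx : 0 < x) (hx2 : x < 1 / 2) :
    deriv f x / f x < 0 := by
  have := h.logDeriv_snd_pos (x := 1 / 2 - x) (by linarith) (by linarith)
  rw [h.deriv_snd_reflect, h.reflect_snd, neg_div] at this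
  linarith

lemma c_pos (h : ThetaPair b c f g) : 0 < c := by
  have hd := fun x => h.snd.hasDerivAt_logDeriv (h.snd_pos x).ne'
  obtain ⟨y, -, hy⟩ := exists_hasDerivAt_eq_zero (f := fun x => deriv g x / g x)
    (a := 0) (b := 1 / 2) (by norm_num) (fun x _ => (hd x).continuousAt.continuousWithinAt)
    (by rw [h.logDeriv_snd_zero, h.logDeriv_snd_half]) (fun x _ => hd x)
  have := h.b_pos
  have h2 : 0 < f y / g y := div_pos (h.fst_pos y) (h.snd_pos y)
  have : 0 < b * (f y / g y) ^ 2 := by positivity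
  linarith

/-- The squared theta quotient plus the squared logarithmic derivative decreases strictly. -/
lemma strictAntiOn_sq_add_sq (h : ThetaPair b c f g) :
    StrictAntiOn (fun x => b * (f x / g x) ^ 2 + (deriv g x / g x) ^ 2) (Set.Icc 0 (1 / 2)) := by
  have hd : ∀ x, HasDerivAt (fun x => b * (f x / g x) ^ 2 + (deriv g x / g x) ^ 2)
      (2 * (b * (f x / g x) ^ 2) * (deriv f x / f x) - 2 * c * (deriv g x / g x)) x := fun x => by
    refine ((((h.fst.hasDerivAt_div h.snd (h.fst_pos x).ne' (h.snd_pos x).ne').pow 2).const_mul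
      b).add ((h.snd.hasDerivAt_logDeriv (h.snd_pos x).ne').pow 2)).congr_deriv ?_
    push_cast
    ring
  refine strictAntiOn_of_deriv_neg (convex_Icc _ _)
    (fun x _ => (hd x).continuousAt.continuousWithinAt) fun x hx => ?_
  rw [interior_Icc] at hx
  rw [(hd x).deriv]
  have h1 := h.b_pos
  have h2 : 0 < f x / g x := div_pos (h.fst_pos x) (h.snd_pos x)
  have h3 : 0 < 2 * (b * (f x / g x) ^ 2) := by positivity
  have h4 := mul_neg_of_pos_of_neg h3 (h.logDeriv_fst_neg hx.1 hx.2)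
  have h5 := mul_pos (mul_pos two_pos h.c_pos) (h.logDeriv_snd_pos hx.1 hx.2)
  linarith

lemma ratio_pos (h : ThetaPair b c f g) : 0 < g 0 ^ 2 / f 0 ^ 2 := by
  have := h.fst_pos 0
  have := h.snd_pos 0
  positivity

lemma ratio_lt_one (h : ThetaPair b c f g) : g 0 ^ 2 / f 0 ^ 2 < 1 := by
  have h1 := h.fst_pos 0
  have h2 := h.snd_pos 0
  have h3 := h.lt 0 le_rfl (by norm_num)
  rw [div_lt_one (by positivity)]
  nlinarith

/-- The real half period as a complete elliptic integral. -/
lemma integral_eq (h : ThetaPair b c f g) {r : ℝ} (hr : r = g 0 ^ 2 / f 0 ^ 2) :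
    ∫ θ in (0 : ℝ)..(π / 2), 1 / √(1 - (1 - r ^ 2) * Real.sin θ ^ 2) = √(b / r) * (1 / 2) := by
  have hb := h.b_pos
  have hr0 : 0 < r := hr ▸ h.ratio_pos
  have hr1 : r < 1 := hr ▸ h.ratio_lt_one
  have hs : 0 < 1 - r ^ 2 := by nlinarith
  have hf0 := h.fst_pos 0
  have hg0 := h.snd_pos 0
  have hD : ∀ x, 0 < f x / g x := fun x => div_pos (h.fst_pos x) (h.snd_pos x)
  have hD0 : r * (f 0 / g 0) ^ 2 = 1 := by rw [hr]; field_simp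
  have hDh : (f (1 / 2) / g (1 / 2)) ^ 2 = r := by
    have e1 := h.reflect 0
    have e2 := h.reflect_snd 0
    rw [sub_zero] at e1 e2
    rw [e1, e2, hr, div_pow]
  have hd := fun x => h.fst.hasDerivAt_div h.snd (h.fst_pos x).ne' (h.snd_pos x).ne'
  have hXd : ∀ x, HasDerivAt (fun x => (1 - r * (f x / g x) ^ 2) / (1 - r ^ 2))
      (-(2 * r * (f x / g x) ^ 2 * (deriv f x / f x - deriv g x / g x)) / (1 - r ^ 2)) x :=
    fun x => by
      refine (((((hd x).pow 2).const_mul r).const_sub 1).div_const (1 - r ^ 2)).congr_deriv ?_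
      push_cast
      ring
  have hanti := h.strictAntiOn_div
  have mem0 : (0 : ℝ) ∈ Set.Icc (0 : ℝ) (1 / 2) := ⟨le_rfl, by norm_num⟩
  have memh : (1 / 2 : ℝ) ∈ Set.Icc (0 : ℝ) (1 / 2) := ⟨by norm_num, le_rfl⟩
  refine integral_eq_of_deriv_sq (by nlinarith) hs.le (Real.sqrt_nonneg _) (by norm_num)
    (fun x _ => (hXd x).continuousAt.continuousWithinAt) ?_ ?_ (fun x hx => ?_) (fun x hx => ?_)
    (fun x _ => hXd x) (fun x hx => ?_) (fun x hx => ?_)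
  · rw [hD0, sub_self, zero_div]
  · rw [hDh, div_eq_one_iff_eq hs.ne']
    ring
  · have h1 := hanti mem0 (Set.Ioo_subset_Icc_self hx) hx.1
    have h2 : (f x / g x) ^ 2 < (f 0 / g 0) ^ 2 := pow_lt_pow_left₀ h1 (hD x).le two_ne_zero
    have := mul_lt_mul_of_pos_left h2 hr0
    exact div_pos (by linarith) hs
  · have h1 := hanti (Set.Ioo_subset_Icc_self hx) memh hx.2
    have h2 : (f (1 / 2) / g (1 / 2)) ^ 2 < (f x / g x) ^ 2 :=
      pow_lt_pow_left₀ h1 (hD _).le two_ne_zero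
    have := mul_lt_mul_of_pos_left h2 hr0
    rw [div_lt_one hs]
    nlinarith
  · have h1 := h.sub_logDeriv_neg hx.1 hx.2
    have h2 : 0 < 2 * r * (f x / g x) ^ 2 := by have := hD x; positivity
    have := mul_neg_of_pos_of_neg h2 h1
    exact div_nonneg (by linarith) hs.le
  · have hen := h.fst.energy h.snd (deriv_zero_of_even h.fst_even)
      (deriv_zero_of_even h.snd_even) (T := 1 / 2) (fun x _ _ => h.fst_pos x)
      (fun x _ _ => h.snd_pos x) hx.1.le hx.2
    have hfx := h.fst_pos x
    have hgx := h.snd_pos x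
    have hg0' : g 0 ^ 2 = r * f 0 ^ 2 := by rw [hr]; field_simp
    rw [hg0'] at hen
    have hen' : r * (deriv f x * g x - deriv g x * f x) ^ 2 =
        b * (g x ^ 2 - r * f x ^ 2) * (f x ^ 2 - r * g x ^ 2) := by
      refine mul_left_cancel₀ (pow_ne_zero 4 hf0.ne') ?_
      linear_combination hen
    rw [Real.sq_sqrt (by positivity)]
    have e1 : deriv f x / f x - deriv g x / g x =
        (deriv f x * g x - deriv g x * f x) / (f x * g x) := by field_simp
    rw [e1]
    have e2 : (deriv f x * g x - deriv g x * f x) ^ 2 =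
        b * (g x ^ 2 - r * f x ^ 2) * (f x ^ 2 - r * g x ^ 2) / r := by
      rw [eq_div_iff hr0.ne']
      linarith
    rw [neg_div, neg_sq, div_pow, mul_pow, div_pow (deriv f x * g x - _), e2]
    field_simp
    ring

end ThetaPair

/-- The imaginary half period as a complete elliptic integral. -/
lemma ThetaODE.integral_eq_of_zero {b c r T : ℝ} {f g : ℝ → ℝ} (hf : ThetaODE (-b) (-c) f g)
    (hg : ThetaODE (-b) (-c) g f) (hb : 0 < b) (hT : 0 < T) (hf0 : deriv f 0 = 0)
    (hg0 : deriv g 0 = 0) (hfpos : ∀ x, 0 < f x) (hgpos : ∀ x, 0 ≤ x → x < T → 0 < g x)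
    (hgT : g T = 0) (hle : ∀ x, g x ≤ f x) (hlt : g 0 < f 0) (hr : r = g 0 ^ 2 / f 0 ^ 2) :
    ∫ θ in (0 : ℝ)..(π / 2), 1 / √(1 - r ^ 2 * Real.sin θ ^ 2) = √(b / r) * T := by
  have hf00 := hfpos 0
  have hg00 := hgpos 0 le_rfl hT
  have hr0 : 0 < r := by rw [hr]; positivity
  have hr1 : r < 1 := by
    rw [hr, div_lt_one (by positivity)]
    nlinarith
  have hs : 0 < 1 - r ^ 2 := by nlinarith
  set e : ℝ → ℝ := fun x => deriv f x / f x - deriv g x / g x with he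
  have hed : ∀ x ∈ Set.Ico 0 T, HasDerivAt e (-b * ((g x / f x) ^ 2 - (f x / g x) ^ 2)) x :=
    fun x hx => hf.hasDerivAt_sub_logDeriv hg (hfpos x).ne' (hgpos x hx.1 hx.2).ne'
  have hDd : ∀ x ∈ Set.Ico 0 T, HasDerivAt (fun x => f x / g x) (f x / g x * e x) x :=
    fun x hx => hf.hasDerivAt_div hg (hfpos x).ne' (hgpos x hx.1 hx.2).ne'
  have hDpos : ∀ x ∈ Set.Ico 0 T, 0 < f x / g x := fun x hx => div_pos (hfpos x) (hgpos x hx.1 hx.2)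
  have he0 : e 0 = 0 := by simp [he, hf0, hg0]
  have hint : interior (Set.Ico 0 T) ⊆ Set.Ico 0 T := interior_subset
  have mem0 : (0 : ℝ) ∈ Set.Ico 0 T := ⟨le_rfl, hT⟩
  have emono : MonotoneOn e (Set.Ico 0 T) := by
    refine monotoneOn_of_deriv_nonneg (convex_Ico _ _)
      (fun x hx => (hed x hx).continuousAt.continuousWithinAt)
      (fun x hx => (hed x (hint hx)).differentiableAt.differentiableWithinAt) fun x hx => ?_
    rw [(hed x (hint hx)).deriv]
    have hgx := hgpos x (hint hx).1 (hint hx).2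
    have h1 : g x / f x ≤ 1 := (div_le_one (hfpos x)).2 (hle x)
    have h2 : 1 ≤ f x / g x := (one_le_div hgx).2 (hle x)
    have h3 : 0 < g x / f x := div_pos hgx (hfpos x)
    have h4 : (g x / f x) ^ 2 ≤ (f x / g x) ^ 2 := by nlinarith
    nlinarith
  have Dmono : MonotoneOn (fun x => f x / g x) (Set.Ico 0 T) := by
    refine monotoneOn_of_deriv_nonneg (convex_Ico _ _)
      (fun x hx => (hDd x hx).continuousAt.continuousWithinAt)
      (fun x hx => (hDd x (hint hx)).differentiableAt.differentiableWithinAt) fun x hx => ?_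
    rw [(hDd x (hint hx)).deriv]
    exact mul_nonneg (hDpos x (hint hx)).le (he0 ▸ emono mem0 (hint hx) (hint hx).1)
  have estrict : StrictMonoOn e (Set.Ico 0 T) := by
    refine strictMonoOn_of_deriv_pos (convex_Ico _ _)
      (fun x hx => (hed x hx).continuousAt.continuousWithinAt) fun x hx => ?_
    rw [(hed x (hint hx)).deriv]
    have hgx := hgpos x (hint hx).1 (hint hx).2
    have h2 : 1 < f x / g x :=
      ((one_lt_div hg00).2 hlt).trans_le (Dmono mem0 (hint hx) (hint hx).1)
    have h1 : g x / f x < 1 := (div_lt_one (hfpos x)).2 ((one_lt_div hgx).1 h2)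
    have h3 : 0 < g x / f x := div_pos hgx (hfpos x)
    have h4 : (g x / f x) ^ 2 < (f x / g x) ^ 2 := by nlinarith
    nlinarith
  have epos : ∀ x ∈ Set.Ioo 0 T, 0 < e x := fun x hx =>
    he0 ▸ estrict mem0 (Set.Ioo_subset_Ico_self hx) hx.1
  have Dstrict : StrictMonoOn (fun x => f x / g x) (Set.Ico 0 T) := by
    refine strictMonoOn_of_deriv_pos (convex_Ico _ _)
      (fun x hx => (hDd x hx).continuousAt.continuousWithinAt) fun x hx => ?_
    rw [(hDd x (hint hx)).deriv]
    rw [interior_Ico] at hx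
    exact mul_pos (hDpos x (Set.Ioo_subset_Ico_self hx)) (epos x hx)
  have hg0' : g 0 ^ 2 = r * f 0 ^ 2 := by rw [hr]; field_simp
  have hA : ∀ x ∈ Set.Ioo 0 T, 0 < r * f x ^ 2 - g x ^ 2 := fun x hx => by
    have h1 := Dstrict mem0 (Set.Ioo_subset_Ico_self hx) hx.1
    have hgx := hgpos x hx.1.le hx.2
    have hfx := hfpos x
    simp only at h1
    rw [div_lt_div_iff₀ hg00 hgx] at h1
    have h2 : (f 0 * g x) ^ 2 < (f x * g 0) ^ 2 := by gcongr
    rw [mul_pow, mul_pow, hg0'] at h2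
    have h3 : 0 < f 0 ^ 2 * (r * f x ^ 2 - g x ^ 2) := by linarith
    exact (pos_iff_pos_of_mul_pos h3).1 (by positivity)
  have hgnn : ∀ x ∈ Set.Icc 0 T, 0 ≤ g x := fun x hx => by
    rcases hx.2.lt_or_eq with h | h
    · exact (hgpos x hx.1 h).le
    · rw [h, hgT]
  have hB : ∀ x ∈ Set.Icc 0 T, 0 < f x ^ 2 - r * g x ^ 2 := fun x hx => by
    have h1 := hgnn x hx
    have h2 := hle x
    have h3 := hfpos x
    have h4 : g x ^ 2 ≤ f x ^ 2 := by gcongr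
    nlinarith [sq_nonneg (g x), pow_pos h3 2]
  have hXd : ∀ x ∈ Set.Icc 0 T,
      HasDerivAt (fun x => (r * f x ^ 2 - g x ^ 2) / (r * (f x ^ 2 - r * g x ^ 2)))
        (2 * (1 - r ^ 2) * f x * g x * (deriv f x * g x - deriv g x * f x) /
          (r * (f x ^ 2 - r * g x ^ 2) ^ 2)) x := fun x hx => by
    have f1 := (hf.differentiable x).hasDerivAt
    have g1 := (hg.differentiable x).hasDerivAt
    have hBx := (hB x hx).ne'
    refine ((((f1.pow 2).const_mul r).sub (g1.pow 2)).div
      (((f1.pow 2).sub ((g1.pow 2).const_mul r)).const_mul r)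
      (mul_ne_zero hr0.ne' hBx)).congr_deriv ?_
    simp only [Pi.pow_apply, Pi.sub_apply]
    field_simp
    ring
  refine integral_eq_of_deriv_sq (by nlinarith) (sq_nonneg r) (Real.sqrt_nonneg _) hT
    (fun x hx => (hXd x hx).continuousAt.continuousWithinAt) ?_ ?_ (fun x hx => ?_)
    (fun x hx => ?_) (fun x hx => hXd x (Set.Ioo_subset_Icc_self hx)) (fun x hx => ?_)
    (fun x hx => ?_)
  · rw [hg0', sub_self, zero_div]
  · rw [hgT]
    have := (hfpos T).ne'
    field_simp
    simp
  · exact div_pos (hA x hx) (mul_pos hr0 (hB x (Set.Ioo_subset_Icc_self hx)))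
  · rw [div_lt_one (mul_pos hr0 (hB x (Set.Ioo_subset_Icc_self hx)))]
    have := pow_pos (hgpos x hx.1.le hx.2) 2
    nlinarith
  · have hgx := hgpos x hx.1.le hx.2
    have hfx := hfpos x
    have hBx := hB x (Set.Ioo_subset_Icc_self hx)
    have h1 := epos x hx
    have e1 : deriv f x * g x - deriv g x * f x = f x * g x * e x := by
      simp only [he]
      field_simp
    rw [e1]
    positivity
  · have hen := hf.energy hg hf0 hg0 (fun x _ _ => hfpos x) hgpos hx.1.le hx.2
    have hfx := hfpos x
    have hgx := hgpos x hx.1.le hx.2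
    have hBx := (hB x (Set.Ioo_subset_Icc_self hx)).ne'
    rw [hg0'] at hen
    have hen' : (deriv f x * g x - deriv g x * f x) ^ 2 =
        b * (r * f x ^ 2 - g x ^ 2) * (f x ^ 2 - r * g x ^ 2) / r := by
      rw [eq_div_iff hr0.ne']
      refine mul_left_cancel₀ (pow_ne_zero 4 hf00.ne') ?_
      linear_combination hen
    rw [Real.sq_sqrt (by positivity), div_pow, mul_pow, hen']
    field_simp
    ring

lemma exists_thetaPair {t : ℝ} (ht : 0 < t) : ∃ b c : ℝ,
    ThetaPair b c (thetaReal t) (fun x => thetaReal t (x + 1 / 2)) ∧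
    ThetaODE (-b) (-c) (thetaImag t) (thetaAlt t) ∧
    ThetaODE (-b) (-c) (thetaAlt t) (thetaImag t) := by
  obtain ⟨b, c, h1, h2, h3, h4⟩ := exists_thetaODE ht
  have hrefl : ∀ x, thetaReal t (1 / 2 - x) = thetaReal t (x + 1 / 2) := fun x => by
    rw [← thetaReal_neg, ← thetaReal_add_one]
    ring_nf
  refine ⟨b, c, ⟨h1, h2, thetaReal_pos ht, fun x => thetaReal_pos ht _, thetaReal_neg,
    fun x => ?_, hrefl, fun x => thetaReal_add_half_lt ht⟩, h3, h4⟩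
  rw [← hrefl]
  ring_nf

lemma continuous_ellK_integrand {k : ℝ} (hk0 : 0 ≤ k) (hk1 : k < 1) :
    Continuous fun θ : ℝ => 1 / √(1 - k ^ 2 * Real.sin θ ^ 2) := by
  refine continuous_const.div (by fun_prop) fun θ => (Real.sqrt_pos.2 ?_).ne'
  have : k ^ 2 < 1 := by nlinarith
  nlinarith [Real.sin_sq_le_one θ, sq_nonneg (Real.sin θ)]

lemma ellK_pos {k : ℝ} (hk0 : 0 ≤ k) (hk1 : k < 1) : 0 < EllK k := by
  refine intervalIntegral.intervalIntegral_pos_of_pos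
    ((continuous_ellK_integrand hk0 hk1).intervalIntegrable _ _) (fun θ => ?_) (by positivity)
  refine one_div_pos.2 (Real.sqrt_pos.2 ?_)
  have : k ^ 2 < 1 := by nlinarith
  nlinarith [Real.sin_sq_le_one θ, sq_nonneg (Real.sin θ)]

lemma ellK_strictMonoOn : StrictMonoOn EllK (Set.Ico 0 1) := by
  intro k hk l hl hkl
  have hsq : k ^ 2 < l ^ 2 := by nlinarith [hk.1]
  have hl2 : l ^ 2 < 1 := by nlinarith [hl.1, hl.2]
  have hp : ∀ θ : ℝ, 0 < 1 - l ^ 2 * Real.sin θ ^ 2 := fun θ => by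
    nlinarith [Real.sin_sq_le_one θ, sq_nonneg (Real.sin θ)]
  refine intervalIntegral.integral_lt_integral_of_continuousOn_of_le_of_exists_lt (by positivity)
    (continuous_ellK_integrand hk.1 hk.2).continuousOn
    (continuous_ellK_integrand hl.1 hl.2).continuousOn (fun θ _ => ?_)
    ⟨π / 2, ⟨by positivity, le_rfl⟩, ?_⟩
  · refine one_div_le_one_div_of_le (Real.sqrt_pos.2 (hp θ)) (Real.sqrt_le_sqrt ?_)
    nlinarith [sq_nonneg (Real.sin θ)]
  · refine one_div_lt_one_div_of_lt (Real.sqrt_pos.2 (hp _)) (Real.sqrt_lt_sqrt (hp _).le ?_)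
    rw [Real.sin_pi_div_two]
    linarith

lemma sqrt_one_sub_sq_mem {k : ℝ} (hk : k ∈ Set.Ioo (0 : ℝ) 1) :
    √(1 - k ^ 2) ∈ Set.Ioo (0 : ℝ) 1 := by
  obtain ⟨h0, h1⟩ := hk
  refine ⟨Real.sqrt_pos.2 (by nlinarith), ?_⟩
  rw [Real.sqrt_lt' one_pos]
  nlinarith

lemma ellK'_strictAntiOn : StrictAntiOn EllK' (Set.Ioo 0 1) := fun k hk l hl hkl => by
  refine ellK_strictMonoOn (Set.Ioo_subset_Ico_self (sqrt_one_sub_sq_mem hl))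
    (Set.Ioo_subset_Ico_self (sqrt_one_sub_sq_mem hk)) (Real.sqrt_lt_sqrt ?_ ?_)
  · nlinarith [hl.1, hl.2]
  · nlinarith [hk.1]

lemma ellK'_pos {k : ℝ} (hk : k ∈ Set.Ioo (0 : ℝ) 1) : 0 < EllK' k :=
  ellK_pos (sqrt_one_sub_sq_mem hk).1.le (sqrt_one_sub_sq_mem hk).2

/-- The ratio of the elliptic integrals determines the modulus. -/
lemma eq_of_ellK'_mul_eq {k s : ℝ} (hk : k ∈ Set.Ioo (0 : ℝ) 1) (hs : s ∈ Set.Ioo (0 : ℝ) 1)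
    (h : EllK' s * EllK k = EllK' k * EllK s) : s = k := by
  have key : ∀ {k s : ℝ}, k ∈ Set.Ioo (0 : ℝ) 1 → s ∈ Set.Ioo (0 : ℝ) 1 → k < s →
      EllK' s * EllK k < EllK' k * EllK s := fun {k s} hk hs hlt =>
    mul_lt_mul'' (ellK'_strictAntiOn hk hs hlt)
      (ellK_strictMonoOn (Set.Ioo_subset_Ico_self hk) (Set.Ioo_subset_Ico_self hs) hlt)
      (ellK'_pos hs).le (ellK_pos hk.1.le hk.2).le
  rcases lt_trichotomy s k with hlt | heq | hlt
  · exact absurd h (key hs hk hlt).ne'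
  · exact heq
  · exact absurd h (key hk hs hlt).ne

/-- The theta functions attached to the modulus `k`, with their normalisation. -/
lemma exists_thetaPair_ellK {k t : ℝ} (hk : k ∈ Set.Ioo (0 : ℝ) 1) (ht : t = EllK' k / EllK k) :
    ∃ c : ℝ, ThetaPair (4 * EllK k ^ 2 * √(1 - k ^ 2)) c (thetaReal t)
      (fun x => thetaReal t (x + 1 / 2)) := by
  have hK := ellK_pos hk.1.le hk.2
  have ht0 : 0 < t := ht ▸ div_pos (ellK'_pos hk) hK
  obtain ⟨b, c, h, hG, hF⟩ := exists_thetaPair ht0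
  have hb := h.b_pos
  have hG0 : thetaImag t 0 = thetaReal t 0 := by simp [thetaImag, thetaReal]
  have hF0 : thetaAlt t 0 = thetaReal t (0 + 1 / 2) := by simp [thetaAlt, thetaReal]
  obtain ⟨r, hr⟩ : ∃ r, r = thetaReal t (0 + 1 / 2) ^ 2 / thetaReal t 0 ^ 2 := ⟨_, rfl⟩
  have hrmem : r ∈ Set.Ioo (0 : ℝ) 1 := ⟨hr ▸ h.ratio_pos, hr ▸ h.ratio_lt_one⟩
  have hs := sqrt_one_sub_sq_mem hrmem
  have hr2 : 0 ≤ 1 - r ^ 2 := by nlinarith [hrmem.1, hrmem.2]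
  have hsr : √(1 - √(1 - r ^ 2) ^ 2) = r := by
    rw [Real.sq_sqrt hr2, sub_sub_cancel, Real.sqrt_sq hrmem.1.le]
  have e1 : EllK √(1 - r ^ 2) = √(b / r) * (1 / 2) := by
    rw [EllK, Real.sq_sqrt hr2]
    exact h.integral_eq hr
  have e2 : EllK' √(1 - r ^ 2) = √(b / r) * (t / 2) := by
    rw [EllK', hsr, EllK]
    refine hG.integral_eq_of_zero hF hb (by positivity) (deriv_zero_of_even thetaImag_neg)
      (deriv_zero_of_even thetaAlt_neg) (thetaImag_pos ht0) (fun x => thetaAlt_pos ht0)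
      (thetaAlt_half t) (thetaAlt_le_thetaImag ht0) ?_ ?_
    · rw [hG0, hF0]
      exact h.lt 0 le_rfl (by norm_num)
    · rw [hG0, hF0, hr]
  have hsk : √(1 - r ^ 2) = k := by
    refine eq_of_ellK'_mul_eq hk hs ?_
    rw [e1, e2, ht]
    field_simp
  rw [hsk] at hsr e1
  refine ⟨c, ?_⟩
  have hb' : 4 * EllK k ^ 2 * √(1 - k ^ 2) = b := by
    rw [hsr, e1, mul_pow, Real.sq_sqrt (div_nonneg hb.le hrmem.1.le)]
    have := hrmem.1.ne'
    field_simp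
    norm_num
  rw [hb']
  exact h

lemma hasSum_thetaReal {t : ℝ} (ht : 0 < t) (x : ℝ) :
    HasSum (fun n : ℕ => 2 * (Real.cos (2 * π * x * (n + 1)) * rexp (-π * (n + 1) ^ 2 * t)))
      (thetaReal t x - 1) := by
  have h := hasSum_nat_cosKernel₀ x ht
  have h3 : cosKernel x t = thetaReal t x := by
    rw [thetaReal, ← cosKernel_def, Complex.ofReal_re]
  rw [h3] at h
  simpa only [mul_assoc] using h

lemma nome_pow (k : ℝ) (n : ℕ) :
    nome k ^ n = rexp (-π * n * (EllK' k / EllK k)) := by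
  rw [nome, ← Real.exp_nat_mul]
  ring_nf

lemma jTheta1_eq {k : ℝ} (hk : k ∈ Set.Ioo (0 : ℝ) 1) (u : ℝ) :
    JTheta1 u k = thetaReal (EllK' k / EllK k) (u / (2 * EllK k)) := by
  have hK := ellK_pos hk.1.le hk.2
  have h := hasSum_thetaReal (div_pos (ellK'_pos hk) hK) (u / (2 * EllK k))
  rw [JTheta1, ← tsum_mul_left]
  have e : ∀ n : ℕ, 2 * (nome k ^ ((n + 1) ^ 2) * Real.cos (((n : ℝ) + 1) * π * u / EllK k)) =
      2 * (Real.cos (2 * π * (u / (2 * EllK k)) * (n + 1)) *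
        rexp (-π * (n + 1) ^ 2 * (EllK' k / EllK k))) := fun n => by
    rw [nome_pow, show ((n : ℝ) + 1) * π * u / EllK k = 2 * π * (u / (2 * EllK k)) * (n + 1) by
      field_simp]
    push_cast
    ring
  rw [tsum_congr e, h.tsum_eq]
  ring

lemma jTheta_eq {k : ℝ} (hk : k ∈ Set.Ioo (0 : ℝ) 1) (u : ℝ) :
    JTheta u k = thetaReal (EllK' k / EllK k) (u / (2 * EllK k) + 1 / 2) := by
  have hK := ellK_pos hk.1.le hk.2
  have h := hasSum_thetaReal (div_pos (ellK'_pos hk) hK) (u / (2 * EllK k) + 1 / 2)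
  rw [JTheta, ← tsum_mul_left]
  have e : ∀ n : ℕ, 2 * ((-1 : ℝ) ^ (n + 1) * nome k ^ ((n + 1) ^ 2) *
      Real.cos (((n : ℝ) + 1) * π * u / EllK k)) =
      2 * (Real.cos (2 * π * (u / (2 * EllK k) + 1 / 2) * (n + 1)) *
        rexp (-π * (n + 1) ^ 2 * (EllK' k / EllK k))) := fun n => by
    rw [nome_pow, show 2 * π * (u / (2 * EllK k) + 1 / 2) * ((n : ℝ) + 1) =
      ((n : ℝ) + 1) * π * u / EllK k + (n + 1 : ℕ) * π by push_cast; field_simp,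
      Real.cos_add_nat_mul_pi]
    push_cast
    ring
  rw [tsum_congr e, h.tsum_eq]
  ring

end

theorem stmt_17 (k : ℝ) (hk : k ∈ Set.Ioo (0:ℝ) 1) :
    StrictAntiOn (fun u => dn u k ^ 2 + zn u k ^ 2) (Set.Ioo 0 (EllK k)) := by
  have hK := ellK_pos hk.1.le hk.2
  obtain ⟨t, ht⟩ : ∃ t, t = EllK' k / EllK k := ⟨_, rfl⟩
  obtain ⟨c, h⟩ := exists_thetaPair_ellK hk ht
  have hr := Real.sqrt_nonneg (1 - k ^ 2)
  set r := √(1 - k ^ 2) with hr_def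
  set g : ℝ → ℝ := fun x => thetaReal t (x + 1 / 2) with hg
  have hJ : ∀ v, JTheta v k = g (v / (2 * EllK k)) := fun v => by rw [jTheta_eq hk, ← ht]
  have key : ∀ u, dn u k ^ 2 + zn u k ^ 2 = (4 * EllK k ^ 2)⁻¹ *
      (4 * EllK k ^ 2 * r * (thetaReal t (u / (2 * EllK k)) / g (u / (2 * EllK k))) ^ 2 +
        (deriv g (u / (2 * EllK k)) / g (u / (2 * EllK k))) ^ 2) := fun u => by
    have hd : deriv (fun v => JTheta v k) u = deriv g (u / (2 * EllK k)) / (2 * EllK k) := by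
      rw [funext hJ]
      exact (((h.snd.differentiable _).hasDerivAt.comp u
        ((hasDerivAt_id u).div_const (2 * EllK k))).congr_deriv (by rw [id_eq]; ring)).deriv
    have hg0 := (h.snd_pos (u / (2 * EllK k))).ne'
    rw [dn, zn, hd, hJ, jTheta1_eq hk, ← ht, ← hr_def, div_pow, mul_pow, Real.sq_sqrt hr]
    generalize u / (2 * EllK k) = x at hg0 ⊢
    generalize deriv g x = g'
    generalize g x = y at hg0 ⊢
    field_simp
    ring
  intro u hu v hv huv
  simp only [key]
  have mem : ∀ w ∈ Set.Ioo 0 (EllK k), w / (2 * EllK k) ∈ Set.Icc (0 : ℝ) (1 / 2) := fun w hw => by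
    refine ⟨div_nonneg hw.1.le (by positivity), ?_⟩
    rw [div_le_iff₀ (by positivity)]
    linarith [hw.2]
  have := h.strictAntiOn_sq_add_sq (mem u hu) (mem v hv) (by gcongr)
  simp only at this
  gcongr
end
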